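/- arXiv:1302.6103 — 3 statements merged into one kernel-verified Lean document; each statement's English description precedes it below -/
import Mathlib

section
/- For α ∈ (0,2), let s_α be the symmetric α-stable density with Fourier transform s_α*(x) = exp(−|x|^α), and for an integer k ≥ 2 put f_{α,k}(x) = s_α(x)^k / ∫ s_α(t)^k dt and r_{α,k} = 1/f_{α,k}*. Then for every ℓ ∈ {0,...,k−1} when α ∈ (0,1), and for every ℓ ∈ {0,...,k} when α ∈ [1,2), there is a constant K_{α,ℓ} > 0 such that |r_{α,k}^{(ℓ)}(x)| ≤ K_{α,ℓ} exp(|x|^α) for all x ∈ ℝ. -/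
open MeasureTheory Filter

noncomputable section

/-- Fourier transform of an integrable function `g : ℝ → ℝ`. -/
def ftC (g : ℝ → ℝ) (w : ℝ) : ℂ :=
  ∫ t : ℝ, Complex.exp (Complex.I * (w : ℂ) * (t : ℂ)) * (g t : ℂ)

/-- The symmetric `α`-stable density `s_α`, whose Fourier transform is `exp(-|x|^α)`,
obtained by Fourier inversion. -/
def salpha (α : ℝ) (x : ℝ) : ℝ :=
  (1 / (2 * Real.pi)) *
    (∫ t : ℝ, Complex.exp (-(Complex.I * (t : ℂ) * (x : ℂ))) * (Real.exp (-|t| ^ α) : ℂ)).re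

/-- The supersmooth density `f_{α,k}(x) = s_α(x)^k / ∫ s_α^k`. -/
def falphak (α : ℝ) (k : ℕ) (x : ℝ) : ℝ :=
  salpha α x ^ k / ∫ t : ℝ, salpha α t ^ k

/-- `r_{α,k} = 1 / f_{α,k}*`. -/
def rfun (α : ℝ) (k : ℕ) (x : ℝ) : ℂ := 1 / ftC (falphak α k) x

/-! ### The characteristic function of the stable law and its derivative -/

/-- The function `x ↦ exp (-|x| ^ α)`. -/
def stableChar (α x : ℝ) : ℝ := Real.exp (-|x| ^ α)

/-- The derivative of `stableChar α` away from the origin, with value `0` at the origin. -/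
def stableCharDeriv (α x : ℝ) : ℝ := -(α * (x * |x| ^ (α - 2))) * stableChar α x

lemma stableChar_pos (α x : ℝ) : 0 < stableChar α x := Real.exp_pos _

lemma continuous_stableChar {α : ℝ} (hα : 0 < α) : Continuous (stableChar α) := by
  unfold stableChar
  exact Real.continuous_exp.comp (continuous_abs.rpow_const fun _ => Or.inr hα.le).neg

lemma integrable_abs_rpow_mul_exp {α p c : ℝ} (hα : 0 < α) (hp : -1 < p) (hc : 0 < c) :
    Integrable fun x : ℝ => |x| ^ p * Real.exp (-c * |x| ^ α) := by
  by_contra h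
  have h1 := integral_undef h
  rw [integral_comp_abs (f := fun x : ℝ => x ^ p * Real.exp (-c * x ^ α)),
    integral_rpow_mul_exp_neg_mul_rpow hα hp hc] at h1
  have : 0 < Real.Gamma ((p + 1) / α) := Real.Gamma_pos_of_pos (div_pos (by linarith) hα)
  have h2 : 0 < 2 * (c ^ (-(p + 1) / α) * (1 / α) * Real.Gamma ((p + 1) / α)) := by positivity
  exact h2.ne' h1

lemma integrable_exp_neg_mul_abs_rpow {α c : ℝ} (hα : 0 < α) (hc : 0 < c) :
    Integrable fun x : ℝ => Real.exp (-c * |x| ^ α) := by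
  simpa using integrable_abs_rpow_mul_exp (p := 0) hα (by norm_num) hc

lemma integrable_stableChar {α : ℝ} (hα : 0 < α) : Integrable (stableChar α) := by
  show Integrable fun x => Real.exp (-|x| ^ α)
  simpa using integrable_exp_neg_mul_abs_rpow hα one_pos

lemma hasDerivAt_stableChar (α : ℝ) {x : ℝ} (hx : x ≠ 0) :
    HasDerivAt (stableChar α) (stableCharDeriv α x) x := by
  have h := (((hasDerivAt_abs hx).rpow_const (p := α) (Or.inl (abs_ne_zero.2 hx))).neg).exp
  refine h.congr_deriv ?_
  have e : |x| ^ (α - 1) = |x| ^ (α - 2) * |x| := by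
    rw [← Real.rpow_add_one (abs_ne_zero.2 hx)]; ring_nf
  have e' : (SignType.sign x : ℝ) * |x| = x := sign_mul_abs x
  simp only [stableCharDeriv, stableChar]
  rw [e, show (SignType.sign x : ℝ) * α * (|x| ^ (α - 2) * |x|)
    = α * (((SignType.sign x : ℝ) * |x|) * |x| ^ (α - 2)) by ring, e',
    Pi.neg_apply]
  ring

lemma abs_stableCharDeriv_le {α : ℝ} (hα : 0 < α) (x : ℝ) :
    |stableCharDeriv α x| ≤ α * |x| ^ (α - 1) * stableChar α x := by
  have hq := (stableChar_pos α x).le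
  rcases eq_or_ne x 0 with rfl | hx
  · simp only [stableCharDeriv, zero_mul, mul_zero, neg_zero, abs_zero]
    have : (0 : ℝ) ≤ 0 ^ (α - 1) := Real.rpow_nonneg le_rfl _
    positivity
  · have e : |x| ^ (α - 1) = |x| * |x| ^ (α - 2) := by
      rw [mul_comm, ← Real.rpow_add_one (abs_ne_zero.2 hx)]; ring_nf
    rw [stableCharDeriv, abs_mul, abs_neg, abs_mul, abs_mul, abs_of_pos hα,
      abs_of_pos (stableChar_pos α x), abs_of_nonneg (Real.rpow_nonneg (abs_nonneg x) _), e]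

lemma measurable_stableCharDeriv (α : ℝ) : Measurable (stableCharDeriv α) := by
  unfold stableCharDeriv stableChar
  fun_prop

lemma continuousAt_stableCharDeriv (α : ℝ) {x : ℝ} (hx : x ≠ 0) :
    ContinuousAt (stableCharDeriv α) x := by
  have h (p : ℝ) : ContinuousAt (fun y : ℝ => |y| ^ p) x :=
    continuousAt_id.abs.rpow_const (Or.inl (abs_ne_zero.2 hx))
  exact ((continuousAt_id.mul (h _)).const_mul α).neg.mul
    (Real.continuous_exp.continuousAt.comp (h α).neg)

lemma integrable_stableCharDeriv {α : ℝ} (hα : 0 < α) : Integrable (stableCharDeriv α) := by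
  refine ((integrable_abs_rpow_mul_exp (p := α - 1) hα (by linarith) one_pos).const_mul α).mono'
    (measurable_stableCharDeriv α).aestronglyMeasurable (Eventually.of_forall fun x => ?_)
  simpa [stableChar, mul_assoc] using abs_stableCharDeriv_le hα x

/-! ### Primitives and convolutions -/

/-- `g` is a primitive of `h` in the sense of the fundamental theorem of calculus. -/
def IsPrimitive (g h : ℝ → ℝ) : Prop := ∀ a b, g b - g a = ∫ u in a..b, h u

lemma isPrimitive_stableChar {α : ℝ} (hα : 0 < α) :
    IsPrimitive (stableChar α) (stableCharDeriv α) := fun _ _ =>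
  (integral_eq_of_hasDerivAt_off_countable _ _ (Set.countable_singleton (0 : ℝ))
    (continuous_stableChar hα).continuousOn (fun _ hx => hasDerivAt_stableChar α hx.2)
    (integrable_stableCharDeriv hα).intervalIntegrable).symm

lemma IsPrimitive.continuous {g h : ℝ → ℝ} (H : IsPrimitive g h) (hh : Integrable h) :
    Continuous g := by
  have : g = fun x => g 0 + ∫ u in (0 : ℝ)..x, h u := by
    ext x; rw [← H 0 x]; ring
  rw [this]
  exact continuous_const.add
    (intervalIntegral.continuous_primitive (fun _ _ => hh.intervalIntegrable) 0)

lemma IsPrimitive.exists_bound {g h : ℝ → ℝ} (H : IsPrimitive g h) (hh : Integrable h) :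
    ∃ C, ∀ x, |g x| ≤ C := by
  refine ⟨|g 0| + ∫ u, |h u|, fun x => ?_⟩
  have h1 : |g x - g 0| ≤ ∫ u, |h u| := by
    rw [H 0 x, ← Real.norm_eq_abs]
    refine (intervalIntegral.norm_integral_le_integral_norm_uIoc).trans ?_
    exact setIntegral_le_integral hh.norm (Eventually.of_forall fun _ => norm_nonneg _)
  have h2 := abs_add_le (g x - g 0) (g 0)
  rw [sub_add_cancel] at h2
  linarith

lemma IsPrimitive.hasDerivAt {g h : ℝ → ℝ} (H : IsPrimitive g h) (hh : Continuous h) (x : ℝ) :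
    HasDerivAt g (h x) x := by
  have : g = fun x => g 0 + ∫ u in (0 : ℝ)..x, h u := by
    ext x; rw [← H 0 x]; ring
  rw [this]
  exact (intervalIntegral.integral_hasDerivAt_right (hh.intervalIntegrable _ _)
    (hh.stronglyMeasurableAtFilter _ _) hh.continuousAt).const_add _

/-- The convolution `x ↦ ∫ f t * g (x - t)`. -/
def realConv (f g : ℝ → ℝ) (x : ℝ) : ℝ := ∫ t, f t * g (x - t)

lemma realConv_comm (f g : ℝ → ℝ) : realConv f g = realConv g f := by
  ext x
  rw [realConv, realConv, ← integral_sub_left_eq_self (fun t => f t * g (x - t)) volume x]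
  simp [mul_comm]

lemma integrable_realConv {f g : ℝ → ℝ} (hf : Integrable f) (hg : Integrable g) :
    Integrable (realConv f g) :=
  hf.integrable_convolution (ContinuousLinearMap.mul ℝ ℝ) hg

lemma integrable_mul_comp_sub {f g : ℝ → ℝ} {C : ℝ} (hf : Integrable f)
    (hg : AEStronglyMeasurable g) (hC : ∀ x, |g x| ≤ C) (x : ℝ) :
    Integrable fun t => f t * g (x - t) := by
  refine hf.mul_bdd (c := C) ?_ (Eventually.of_forall fun t => hC _)
  exact hg.comp_measurePreserving (Measure.measurePreserving_sub_left volume x)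

lemma IsPrimitive.realConv {f g h : ℝ → ℝ} (H : IsPrimitive g h) (hf : Integrable f)
    (hh : Integrable h) : IsPrimitive (realConv f g) (realConv f h) := by
  intro a b
  obtain ⟨C, hC⟩ := H.exists_bound hh
  have hm := (H.continuous hh).aestronglyMeasurable (μ := volume)
  have hswap : ∀ {a b : ℝ}, a ≤ b →
      ∫ t, f t * (g (b - t) - g (a - t)) = ∫ u in a..b, _root_.realConv f h u := by
    intro a b hab
    have h1 : Integrable (Function.uncurry fun u t => f t * h (u - t))
        ((volume.restrict (Set.Ioc a b)).prod volume) := by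
      have := hf.convolution_integrand (ContinuousLinearMap.mul ℝ ℝ) hh
      rw [Measure.restrict_prod_eq_prod_univ]
      exact this.restrict
    rw [intervalIntegral.integral_of_le hab]
    simp only [_root_.realConv]
    rw [integral_integral_swap h1]
    refine integral_congr_ae (Eventually.of_forall fun t => ?_)
    simp only
    rw [integral_const_mul, ← intervalIntegral.integral_of_le hab,
      intervalIntegral.integral_comp_sub_right, H]
  have hsub : ∀ a b : ℝ, _root_.realConv f g b - _root_.realConv f g a
      = ∫ t, f t * (g (b - t) - g (a - t)) := by
    intro a b
    rw [_root_.realConv, _root_.realConv, ← integral_sub (integrable_mul_comp_sub hf hm hC b)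
      (integrable_mul_comp_sub hf hm hC a)]
    simp [mul_sub]
  rcases le_total a b with hab | hab
  · rw [hsub, hswap hab]
  · rw [intervalIntegral.integral_symm, ← hswap hab, ← hsub]; ring

lemma continuous_realConv {f g : ℝ → ℝ} {C : ℝ} (hf : Integrable f) (hg : Measurable g)
    (hC : ∀ x, |g x| ≤ C) (hc : ∀ x ≠ 0, ContinuousAt g x) : Continuous (realConv f g) := by
  rw [continuous_iff_continuousAt]
  intro x
  refine continuousAt_of_dominated (bound := fun t => |f t| * C) ?_ ?_ (hf.abs.mul_const C) ?_
  · exact Eventually.of_forall fun y => (hf.aestronglyMeasurable).mul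
      (hg.comp (measurable_const.sub measurable_id)).aestronglyMeasurable
  · refine Eventually.of_forall fun y => Eventually.of_forall fun t => ?_
    rw [Real.norm_eq_abs, abs_mul]
    exact mul_le_mul_of_nonneg_left (hC _) (abs_nonneg _)
  · filter_upwards [compl_mem_ae_iff.2 (measure_singleton x)] with t ht
    refine continuousAt_const.mul ?_
    have : x - t ≠ 0 := sub_ne_zero.2 fun h => ht (by simp [h])
    exact ContinuousAt.comp (f := fun y => y - t) (hc _ this) (by fun_prop)

lemma abs_realConv_le {f g : ℝ → ℝ} {C : ℝ} (hf : Integrable f) (hC : ∀ x, |g x| ≤ C) (x : ℝ) :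
    |realConv f g x| ≤ (∫ t, |f t|) * C := by
  rw [← integral_mul_const, ← Real.norm_eq_abs]
  refine norm_integral_le_of_norm_le (hf.abs.mul_const C) (Eventually.of_forall fun t => ?_)
  rw [Real.norm_eq_abs, abs_mul]
  exact mul_le_mul_of_nonneg_left (hC _) (abs_nonneg _)

lemma rpow_sub_one_le_inv_mul_exp {α δ t : ℝ} (hα : 1 ≤ α) (hδ : 0 < δ) (hδ1 : δ ≤ 1)
    (ht : 0 ≤ t) : t ^ (α - 1) ≤ δ⁻¹ * Real.exp (δ * t ^ α) := by
  have h1 : t ^ (α - 1) ≤ 1 + t ^ α := by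
    rcases le_total t 1 with h | h
    · have := Real.rpow_le_one ht h (by linarith : 0 ≤ α - 1)
      have := Real.rpow_nonneg ht α
      linarith
    · have := Real.rpow_le_rpow_of_exponent_le h (by linarith : α - 1 ≤ α)
      linarith
  have h2 := Real.add_one_le_exp (δ * t ^ α)
  rw [inv_mul_eq_div, le_div_iff₀ hδ]
  nlinarith [Real.rpow_nonneg ht α]

lemma abs_stableCharDeriv_le_exp {α δ : ℝ} (hα : 1 ≤ α) (hδ : 0 < δ) (hδ1 : δ ≤ 1) (x : ℝ) :
    |stableCharDeriv α x| ≤ α * δ⁻¹ * Real.exp (-((1 - δ) * |x| ^ α)) := by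
  refine (abs_stableCharDeriv_le (by linarith) x).trans ?_
  have e : Real.exp (-((1 - δ) * |x| ^ α)) = Real.exp (δ * |x| ^ α) * stableChar α x := by
    rw [stableChar, ← Real.exp_add]; ring_nf
  rw [e]
  have h := rpow_sub_one_le_inv_mul_exp hα hδ hδ1 (abs_nonneg x)
  have hq := stableChar_pos α x
  calc α * |x| ^ (α - 1) * stableChar α x
      ≤ α * (δ⁻¹ * Real.exp (δ * |x| ^ α)) * stableChar α x := by gcongr
    _ = _ := by ring

/-! ### Iterated convolutions -/

/-- `stableConv α n 0` is the `(n + 1)`-fold convolution of `stableChar α`, and `stableConv α n j`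
is obtained from it by replacing `j` of the factors by `stableCharDeriv α`. -/
def stableConv (α : ℝ) : ℕ → ℕ → ℝ → ℝ
  | 0, 0 => stableChar α
  | 0, _ + 1 => stableCharDeriv α
  | n + 1, 0 => realConv (stableChar α) (stableConv α n 0)
  | n + 1, j + 1 => realConv (stableCharDeriv α) (stableConv α n j)

lemma integrable_stableConv {α : ℝ} (hα : 0 < α) (n j : ℕ) : Integrable (stableConv α n j) := by
  induction n generalizing j with
  | zero => cases j with
    | zero => exact integrable_stableChar hα
    | succ j => exact integrable_stableCharDeriv hα
  | succ n ih => cases j with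
    | zero => exact integrable_realConv (integrable_stableChar hα) (ih 0)
    | succ j => exact integrable_realConv (integrable_stableCharDeriv hα) (ih j)

lemma isPrimitive_stableConv {α : ℝ} (hα : 0 < α) {n j : ℕ} (hj : j ≤ n) :
    IsPrimitive (stableConv α n j) (stableConv α n (j + 1)) := by
  induction n generalizing j with
  | zero =>
    obtain rfl : j = 0 := by omega
    exact isPrimitive_stableChar hα
  | succ n ih => cases j with
    | zero =>
      simp only [stableConv]
      rw [realConv_comm (stableChar α), realConv_comm (stableCharDeriv α)]
      exact (isPrimitive_stableChar hα).realConv (integrable_stableConv hα n 0)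
        (integrable_stableCharDeriv hα)
    | succ j =>
      exact (ih (by omega)).realConv (integrable_stableCharDeriv hα)
        (integrable_stableConv hα n (j + 1))

lemma continuous_stableConv {α : ℝ} (hα : 0 < α) {n j : ℕ} (hj : j ≤ n) :
    Continuous (stableConv α n j) :=
  (isPrimitive_stableConv hα hj).continuous (integrable_stableConv hα _ _)

lemma exists_bound_stableConv {α : ℝ} (hα : 0 < α) {n j : ℕ} (hj : j ≤ n) :
    ∃ C, ∀ x, |stableConv α n j x| ≤ C :=
  (isPrimitive_stableConv hα hj).exists_bound (integrable_stableConv hα _ _)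

lemma stableConv_top_regular {α : ℝ} (hα : 1 ≤ α) (n : ℕ) :
    (∃ C, ∀ x, |stableConv α n (n + 1) x| ≤ C) ∧ Measurable (stableConv α n (n + 1)) ∧
      ∀ x ≠ 0, ContinuousAt (stableConv α n (n + 1)) x := by
  have hi := integrable_stableCharDeriv (zero_lt_one.trans_le hα)
  induction n with
  | zero =>
    refine ⟨⟨α, fun x => ?_⟩, measurable_stableCharDeriv α,
      fun x hx => continuousAt_stableCharDeriv α hx⟩
    simpa [stableConv] using abs_stableCharDeriv_le_exp hα one_pos le_rfl x
  | succ n ih =>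
    obtain ⟨⟨C, hC⟩, hm, hc⟩ := ih
    have hcont := continuous_realConv hi hm hC hc
    exact ⟨⟨_, abs_realConv_le hi hC⟩, hcont.measurable, fun x _ => hcont.continuousAt⟩

lemma continuous_stableConv_top {α : ℝ} (hα : 1 ≤ α) (n : ℕ) :
    Continuous (stableConv α (n + 1) (n + 2)) := by
  obtain ⟨⟨C, hC⟩, hm, hc⟩ := stableConv_top_regular hα n
  exact continuous_realConv (integrable_stableCharDeriv (zero_lt_one.trans_le hα)) hm hC hc

lemma stableConv_nonneg (α : ℝ) (n : ℕ) (x : ℝ) : 0 ≤ stableConv α n 0 x := by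
  induction n generalizing x with
  | zero => exact (stableChar_pos α x).le
  | succ n ih => exact integral_nonneg fun t => mul_nonneg (stableChar_pos α t).le (ih _)

lemma integrable_stableChar_mul_stableConv {α : ℝ} (hα : 0 < α) (n : ℕ) (x : ℝ) :
    Integrable fun t => stableChar α t * stableConv α n 0 (x - t) := by
  obtain ⟨C, hC⟩ := exists_bound_stableConv hα (Nat.zero_le n)
  exact integrable_mul_comp_sub (integrable_stableChar hα)
    (integrable_stableConv hα n 0).aestronglyMeasurable hC x

/-! ### Derivatives of a reciprocal -/

lemma iteratedDeriv_eq_of_hasDerivAt {V : ℕ → ℝ → ℂ} {n : ℕ}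
    (hV : ∀ j < n, ∀ x, HasDerivAt (V j) (V (j + 1) x) x) {j : ℕ} (hj : j ≤ n) :
    iteratedDeriv j (V 0) = V j := by
  induction j with
  | zero => simp
  | succ j ih =>
    rw [iteratedDeriv_succ, ih (by omega)]
    exact funext fun x => (hV j (by omega) x).deriv

lemma exists_norm_iteratedDeriv_inv_le {V : ℕ → ℝ → ℂ} {n : ℕ}
    (hV : ∀ j < n, ∀ x, HasDerivAt (V j) (V (j + 1) x) x) (hc : Continuous (V n))
    (h0 : ∀ x, V 0 x ≠ 0) {E : ℝ → ℝ} (hE : ∀ x, 1 ≤ E x)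
    (hb : ∀ j ≤ n, ∃ C, ∀ x, ‖V j x‖ ≤ C * ‖V 0 x‖ * E x) {j : ℕ} (hj : j ≤ n) :
    ∃ K > 0, ∀ x, ‖iteratedDeriv j (fun x => (V 0 x)⁻¹) x‖ * ‖V 0 x‖ ≤ K * E x ^ j := by
  have hit {j : ℕ} (hj : j ≤ n) := iteratedDeriv_eq_of_hasDerivAt hV hj
  have hcd : ContDiff ℝ n (V 0) := by
    refine contDiff_nat_iff_iteratedDeriv.2 ⟨fun m hm => ?_, fun m hm => ?_⟩
    · rw [hit hm]
      rcases hm.lt_or_eq with h | rfl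
      · exact continuous_iff_continuousAt.2 fun x => (hV m h x).continuousAt
      · exact hc
    · rw [hit hm.le]
      exact fun x => (hV m hm x).differentiableAt
  have hcdi : ContDiff ℝ n fun x => (V 0 x)⁻¹ := hcd.inv h0
  induction j using Nat.strong_induction_on with
  | _ j ih =>
    rcases Nat.eq_zero_or_pos j with rfl | hpos
    · refine ⟨1, one_pos, fun x => ?_⟩
      simp [h0 x]
    choose! K hK0 hK using fun m (hm : m < j) => ih m hm (by omega)
    choose! C hC using hb
    refine ⟨1 + ∑ i ∈ Finset.range j, |(j.choose (i + 1) : ℝ) * C (i + 1) * K (j - (i + 1))|,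
      by positivity, fun x => ?_⟩
    have hE0 : 0 < E x := zero_lt_one.trans_le (hE x)
    have hmul := iteratedDeriv_mul (x := x) (n := j)
      (hcd.contDiffAt.of_le (by exact_mod_cast hj)) (hcdi.contDiffAt.of_le (by exact_mod_cast hj))
    have hone : (V 0 * fun x => (V 0 x)⁻¹) = fun _ => (1 : ℂ) :=
      funext fun x => mul_inv_cancel₀ (h0 x)
    rw [hone, iteratedDeriv_const, if_neg hpos.ne', Finset.sum_range_succ'] at hmul
    simp only [Nat.choose_zero_right, Nat.cast_one, one_mul, iteratedDeriv_zero, Nat.sub_zero]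
      at hmul
    rw [mul_comm, ← norm_mul, ← neg_eq_of_add_eq_zero_right hmul.symm, norm_neg]
    refine (norm_sum_le _ _).trans ?_
    rw [add_mul, Finset.sum_mul]
    refine le_add_of_nonneg_of_le (by positivity) (Finset.sum_le_sum fun i hi => ?_)
    have hij : i + 1 ≤ j := Finset.mem_range.1 hi
    rw [hit (hij.trans hj), norm_mul, norm_mul, Complex.norm_natCast]
    have hlt : j - (i + 1) < j := by omega
    have hCE : 0 ≤ C (i + 1) * ‖V 0 x‖ * E x := (norm_nonneg _).trans (hC (i + 1) (by omega) x)
    have hV0 : 0 < ‖V 0 x‖ := norm_pos_iff.2 (h0 x)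
    have hC0 : 0 ≤ C (i + 1) := by
      by_contra h
      nlinarith [mul_pos (mul_pos (neg_pos.2 (not_le.1 h)) hV0) hE0]
    have hK0' := (hK0 _ hlt).le
    rw [abs_of_nonneg (by positivity)]
    calc (j.choose (i + 1) : ℝ) * ‖V (i + 1) x‖ * ‖iteratedDeriv (j - (i + 1)) _ x‖
        ≤ j.choose (i + 1) * (C (i + 1) * ‖V 0 x‖ * E x)
            * ‖iteratedDeriv (j - (i + 1)) (fun x => (V 0 x)⁻¹) x‖ := by
          gcongr; exact hC _ (by omega) x
      _ = j.choose (i + 1) * C (i + 1) * E x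
            * (‖iteratedDeriv (j - (i + 1)) (fun x => (V 0 x)⁻¹) x‖ * ‖V 0 x‖) := by ring
      _ ≤ j.choose (i + 1) * C (i + 1) * E x * (K (j - (i + 1)) * E x ^ (j - (i + 1))) := by
          exact mul_le_mul_of_nonneg_left (hK _ hlt x) (by positivity)
      _ = j.choose (i + 1) * C (i + 1) * K (j - (i + 1)) * E x ^ (j - (i + 1) + 1) := by ring
      _ ≤ j.choose (i + 1) * C (i + 1) * K (j - (i + 1)) * E x ^ j := by
          gcongr
          · exact hE x
          · omega

/-! ### Bounds on the iterated convolutions -/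

lemma le_integral_of_le_on_Icc {F : ℝ → ℝ} (hF : Integrable F) (hF0 : ∀ t, 0 ≤ F t) {v a : ℝ}
    (h : ∀ t ∈ Set.Icc a (a + 1), v ≤ F t) : v ≤ ∫ t, F t := by
  calc v = ∫ _ in Set.Icc a (a + 1), v := by simp
    _ ≤ ∫ t in Set.Icc a (a + 1), F t :=
        setIntegral_mono_on (by simp) hF.integrableOn measurableSet_Icc h
    _ ≤ ∫ t, F t := setIntegral_le_integral hF (Eventually.of_forall hF0)

lemma stableChar_mul_le {α : ℝ} (hα : 0 < α) (hα1 : α ≤ 1) (x t : ℝ) :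
    stableChar α x * stableChar α t ≤ stableChar α (x - t) := by
  rw [stableChar, stableChar, stableChar, ← Real.exp_add, Real.exp_le_exp]
  have h1 := Real.rpow_le_rpow (abs_nonneg _) (abs_sub x t) hα.le
  have h2 := Real.rpow_add_le_add_rpow (abs_nonneg x) (abs_nonneg t) hα.le hα1
  linarith

lemma exists_mul_stableChar_le_stableConv {α : ℝ} (hα : 0 < α) (hα1 : α ≤ 1) (n : ℕ) :
    ∃ c > 0, ∀ x, c * stableChar α x ≤ stableConv α n 0 x := by
  induction n with
  | zero => exact ⟨1, one_pos, fun x => by simp [stableConv]⟩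
  | succ n ih =>
    obtain ⟨c, hc, h⟩ := ih
    refine ⟨c * Real.exp (-2), by positivity, fun x => ?_⟩
    refine le_integral_of_le_on_Icc (a := 0) (integrable_stableChar_mul_stableConv hα n x)
      (fun t => mul_nonneg (stableChar_pos α t).le (stableConv_nonneg α n _)) fun t ht => ?_
    rw [zero_add] at ht
    have ht1 : |t| ^ α ≤ 1 := Real.rpow_le_one (abs_nonneg t)
      (by rw [abs_of_nonneg ht.1]; exact ht.2) hα.le
    have hq : Real.exp (-2) ≤ stableChar α t * stableChar α t := by
      rw [stableChar, ← Real.exp_add, Real.exp_le_exp]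
      linarith
    have hqt := stableChar_pos α t
    have hqx := stableChar_pos α x
    calc c * Real.exp (-2) * stableChar α x
        ≤ c * (stableChar α t * stableChar α t) * stableChar α x := by gcongr
      _ = stableChar α t * (c * (stableChar α x * stableChar α t)) := by ring
      _ ≤ stableChar α t * (c * stableChar α (x - t)) := by
          gcongr; exact stableChar_mul_le hα hα1 x t
      _ ≤ stableChar α t * stableConv α n 0 (x - t) := by gcongr; exact h _

lemma abs_stableConv_one_le (n j : ℕ) (x : ℝ) : |stableConv 1 n j x| ≤ stableConv 1 n 0 x := by
  have hd (t : ℝ) : |stableCharDeriv 1 t| ≤ stableChar 1 t := by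
    simpa using abs_stableCharDeriv_le one_pos t
  induction n generalizing j x with
  | zero => cases j with
    | zero => exact (abs_of_pos (stableChar_pos 1 x)).le
    | succ j => exact hd x
  | succ n ih => cases j with
    | zero => exact (abs_of_nonneg (stableConv_nonneg 1 (n + 1) x)).le
    | succ j =>
      rw [← Real.norm_eq_abs]
      refine norm_integral_le_of_norm_le (integrable_stableChar_mul_stableConv one_pos n x)
        (Eventually.of_forall fun t => ?_)
      rw [Real.norm_eq_abs, abs_mul]
      exact mul_le_mul (hd t) (ih _ _) (abs_nonneg _) (stableChar_pos 1 t).le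

lemma rpow_add_mul_min_rpow_le {α a b : ℝ} (hα : 0 < α) (hα1 : α ≤ 1) (hb : 0 ≤ b) (hab : b ≤ a) :
    (a + b) ^ α + (1 - α) * b ^ α ≤ a ^ α + b ^ α := by
  rcases hb.eq_or_lt with rfl | hb'
  · simp [Real.zero_rpow hα.ne']
  have ha : 0 < a := hb'.trans_le hab
  have h1 : (a + b) ^ α ≤ a ^ α * (1 + α * (b / a)) := by
    have e : a + b = a * (1 + b / a) := by field_simp
    rw [e, Real.mul_rpow ha.le (by positivity)]
    gcongr
    exact rpow_one_add_le_one_add_mul_self (neg_one_lt_zero.le.trans (by positivity)) hα.le hα1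
  have h2 : a ^ α * (b / a) ≤ b ^ α := by
    have h3 : (b / a) ≤ (b / a) ^ α := by
      have hle : b / a ≤ 1 := (div_le_one ha).2 hab
      simpa using Real.rpow_le_rpow_of_exponent_ge (by positivity : 0 < b / a) hle hα1
    calc a ^ α * (b / a) ≤ a ^ α * (b / a) ^ α := by gcongr
      _ = b ^ α := by rw [← Real.mul_rpow ha.le (by positivity)]; field_simp
  nlinarith

lemma abs_rpow_mul_stableChar_mul_le {α p : ℝ} (hα : 0 < α) (hα1 : α ≤ 1) (hp : p ≤ 0)
    {x t : ℝ} (hxt : x - t ≠ 0) :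
    |t| ^ p * stableChar α t * stableChar α (x - t) ≤ stableChar α x *
      (|t| ^ p * Real.exp (-(1 - α) * |t| ^ α)
        + |x - t| ^ p * Real.exp (-(1 - α) * |x - t| ^ α)) := by
  have key : ∀ {a b : ℝ}, |b| ≤ |a| →
      stableChar α a * stableChar α b
        ≤ stableChar α (a + b) * Real.exp (-(1 - α) * |b| ^ α) := by
    intro a b hab
    rw [stableChar, stableChar, stableChar, ← Real.exp_add, ← Real.exp_add, Real.exp_le_exp]
    have h1 := rpow_add_mul_min_rpow_le hα hα1 (abs_nonneg b) hab
    have h2 := Real.rpow_le_rpow (abs_nonneg _) (abs_add_le a b) hα.le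
    linarith
  have hx := stableChar_pos α x
  have h1 := Real.rpow_nonneg (abs_nonneg t) p
  have h2 := Real.rpow_nonneg (abs_nonneg (x - t)) p
  rcases le_total |t| |x - t| with h | h
  · have := key h
    rw [sub_add_cancel] at this
    calc |t| ^ p * stableChar α t * stableChar α (x - t)
        = |t| ^ p * (stableChar α (x - t) * stableChar α t) := by ring
      _ ≤ |t| ^ p * (stableChar α x * Real.exp (-(1 - α) * |t| ^ α)) := by gcongr
      _ = stableChar α x * (|t| ^ p * Real.exp (-(1 - α) * |t| ^ α)) := by ring
      _ ≤ _ := by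
        gcongr
        exact le_add_of_nonneg_right (by positivity)
  · have := key h
    rw [add_sub_cancel] at this
    have hpow : |t| ^ p ≤ |x - t| ^ p :=
      Real.rpow_le_rpow_of_nonpos (abs_pos.2 hxt) h hp
    have hqt := stableChar_pos α t
    have hqt' := stableChar_pos α (x - t)
    calc |t| ^ p * stableChar α t * stableChar α (x - t)
        ≤ |x - t| ^ p * stableChar α t * stableChar α (x - t) := by gcongr
      _ = |x - t| ^ p * (stableChar α t * stableChar α (x - t)) := by ring
      _ ≤ |x - t| ^ p * (stableChar α x * Real.exp (-(1 - α) * |x - t| ^ α)) := by gcongr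
      _ = stableChar α x * (|x - t| ^ p * Real.exp (-(1 - α) * |x - t| ^ α)) := by ring
      _ ≤ _ := by
        gcongr
        exact le_add_of_nonneg_left (by positivity)

lemma exists_abs_realConv_le_stableChar {α p A C : ℝ} (hα : 0 < α) (hα1 : α < 1) (hp : p ≤ 0)
    (hp1 : -1 < p) {f g : ℝ → ℝ} (hA : 0 ≤ A)
    (hf : ∀ t, |f t| ≤ A * |t| ^ p * stableChar α t) (hg : ∀ t, |g t| ≤ C * stableChar α t) :
    ∃ D, ∀ x, |realConv f g x| ≤ D * stableChar α x := by
  set w : ℝ → ℝ := fun t => |t| ^ p * Real.exp (-(1 - α) * |t| ^ α) with hw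
  have hwi : Integrable w := integrable_abs_rpow_mul_exp hα hp1 (by linarith)
  have hC : 0 ≤ C := by
    have := (abs_nonneg _).trans (hg 0)
    have := stableChar_pos α 0
    by_contra h
    nlinarith
  refine ⟨A * C * ((∫ t, w t) + ∫ t, w t), fun x => ?_⟩
  have hwi' : Integrable fun t => w (x - t) := hwi.comp_sub_left x
  have hInt : Integrable fun t => A * C * (stableChar α x * (w t + w (x - t))) :=
    ((hwi.add hwi').const_mul _).const_mul _
  have hval : ∫ t, A * C * (stableChar α x * (w t + w (x - t)))
      = A * C * ((∫ t, w t) + ∫ t, w t) * stableChar α x := by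
    rw [integral_const_mul, integral_const_mul, integral_add hwi hwi',
      integral_sub_left_eq_self]
    ring
  rw [← hval, ← Real.norm_eq_abs]
  refine norm_integral_le_of_norm_le hInt ?_
  filter_upwards [compl_mem_ae_iff.2 (measure_singleton x)] with t htx
  have hx : x - t ≠ 0 := sub_ne_zero.2 (Ne.symm htx)
  have hqt := stableChar_pos α t
  have h1 := Real.rpow_nonneg (abs_nonneg t) p
  rw [Real.norm_eq_abs, abs_mul]
  calc |f t| * |g (x - t)|
      ≤ (A * |t| ^ p * stableChar α t) * (C * stableChar α (x - t)) := by
        gcongr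
        · exact hf t
        · exact hg _
    _ = A * C * (|t| ^ p * stableChar α t * stableChar α (x - t)) := by ring
    _ ≤ _ := mul_le_mul_of_nonneg_left (abs_rpow_mul_stableChar_mul_le hα hα1.le hp hx)
        (mul_nonneg hA hC)

lemma exists_abs_stableConv_le_stableChar {α : ℝ} (hα : 0 < α) (hα1 : α < 1) {n j : ℕ}
    (hj : j ≤ n) : ∃ C, ∀ x, |stableConv α n j x| ≤ C * stableChar α x := by
  induction n generalizing j with
  | zero =>
    obtain rfl : j = 0 := by omega
    exact ⟨1, fun x => by simp [stableConv, abs_of_pos (stableChar_pos α x)]⟩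
  | succ n ih => cases j with
    | zero =>
      obtain ⟨C, hC⟩ := ih (Nat.zero_le n)
      exact exists_abs_realConv_le_stableChar (p := 0) (A := 1) hα hα1 le_rfl (by norm_num)
        zero_le_one (fun t => by simp [abs_of_pos (stableChar_pos α t)]) hC
    | succ j =>
      obtain ⟨C, hC⟩ := ih (by omega : j ≤ n)
      exact exists_abs_realConv_le_stableChar (p := α - 1) hα hα1 (by linarith) (by linarith)
        hα.le (abs_stableCharDeriv_le hα) hC

/-- The minimum of `|y₀| ^ α + ⋯ + |yₙ| ^ α` subject to `y₀ + ⋯ + yₙ = x`, for `1 ≤ α`. -/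
def splitCost (α : ℝ) (n : ℕ) (x : ℝ) : ℝ := (n + 1) * (|x| / (n + 1)) ^ α

lemma splitCost_zero (α x : ℝ) : splitCost α 0 x = |x| ^ α := by simp [splitCost]

lemma splitCost_nonneg (α : ℝ) (n : ℕ) (x : ℝ) : 0 ≤ splitCost α n x := by
  unfold splitCost; positivity

lemma splitCost_eq (α : ℝ) (n : ℕ) (x : ℝ) :
    splitCost α n x = ((n : ℝ) + 1) ^ (1 - α) * |x| ^ α := by
  have hn : (0 : ℝ) < n + 1 := by positivity
  rw [splitCost, Real.div_rpow (abs_nonneg x) hn.le, Real.rpow_sub hn, Real.rpow_one]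
  ring

lemma splitCost_succ_le {α : ℝ} (hα : 1 ≤ α) (n : ℕ) (x t : ℝ) :
    splitCost α (n + 1) x ≤ |t| ^ α + splitCost α n (x - t) := by
  have hn : (0 : ℝ) < n + 1 := by positivity
  have hn2 : (0 : ℝ) < n + 2 := by positivity
  have hy : |x - t| / (n + 1) ∈ Set.Ici (0 : ℝ) := by simp only [Set.mem_Ici]; positivity
  have hconv := (convexOn_rpow hα).2 (abs_nonneg t) hy
    (by positivity : (0 : ℝ) ≤ 1 / (n + 2)) (by positivity : (0 : ℝ) ≤ (n + 1) / (n + 2))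
    (by field_simp; ring)
  simp only [smul_eq_mul] at hconv
  have hle : |x| / (n + 2) ≤ 1 / (n + 2) * |t| + (n + 1) / (n + 2) * (|x - t| / (n + 1)) := by
    have e : 1 / (n + 2) * |t| + (n + 1) / (n + 2) * (|x - t| / (n + 1))
      = (|t| + |x - t|) / ((n : ℝ) + 2) := by field_simp
    rw [e]
    gcongr
    simpa using abs_add_le t (x - t)
  have h := (Real.rpow_le_rpow (by positivity) hle (by linarith)).trans hconv
  have e2 : ((n + 1 : ℕ) : ℝ) + 1 = n + 2 := by push_cast; ring
  rw [splitCost, splitCost, e2]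
  calc ((n : ℝ) + 2) * (|x| / (n + 2)) ^ α
      ≤ (n + 2) * (1 / (n + 2) * |t| ^ α + (n + 1) / (n + 2) * (|x - t| / (n + 1)) ^ α) := by
        gcongr
    _ = _ := by field_simp

lemma exists_add_one_rpow_le {α β : ℝ} (hα : 0 < α) (hβ : 1 < β) :
    ∃ K, ∀ a, 0 ≤ a → (a + 1) ^ α ≤ β * a ^ α + K := by
  set γ := β ^ α⁻¹ with hγ
  have hγ1 : 1 < γ := Real.one_lt_rpow hβ (by positivity)
  have hγα : γ ^ α = β := Real.rpow_inv_rpow (by linarith) hα.ne'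
  have hγ0 : 0 < γ - 1 := by linarith
  refine ⟨((γ - 1)⁻¹ + 1) ^ α, fun a ha => ?_⟩
  rcases le_total (γ - 1)⁻¹ a with h | h
  · have h1 : a + 1 ≤ γ * a := by
      have := (inv_le_iff_one_le_mul₀ hγ0).1 h
      linarith
    have h2 := Real.rpow_le_rpow (by linarith) h1 hα.le
    rw [Real.mul_rpow (by linarith) ha, hγα] at h2
    have : 0 ≤ ((γ - 1)⁻¹ + 1) ^ α := by positivity
    linarith
  · have h1 := Real.rpow_le_rpow (by linarith) (by linarith : a + 1 ≤ (γ - 1)⁻¹ + 1) hα.le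
    have : 0 ≤ β * a ^ α := by positivity
    linarith

lemma exists_mul_exp_le_stableConv {α b : ℝ} (hα : 0 < α) (hb : 1 < b) (n : ℕ) :
    ∃ c > 0, ∀ x, c * Real.exp (-(b * splitCost α n x)) ≤ stableConv α n 0 x := by
  induction n generalizing b with
  | zero =>
    refine ⟨1, one_pos, fun x => ?_⟩
    rw [one_mul, splitCost_zero, stableConv, stableChar, Real.exp_le_exp]
    nlinarith [Real.rpow_nonneg (abs_nonneg x) α]
  | succ n ih =>
    obtain ⟨b', hb1, hbb⟩ := exists_between hb
    obtain ⟨c, hc, h⟩ := ih hb1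
    have hb0 : 0 < b' := by linarith
    obtain ⟨K, hK⟩ := exists_add_one_rpow_le hα ((one_lt_div hb0).2 hbb)
    refine ⟨c * Real.exp (-(b' * ((n + 2) * K))), by positivity, fun x => ?_⟩
    refine le_integral_of_le_on_Icc (a := x / (n + 2))
      (integrable_stableChar_mul_stableConv hα n x)
      (fun t => mul_nonneg (stableChar_pos α t).le (stableConv_nonneg α n _)) fun t ht => ?_
    have hn : (0 : ℝ) < n + 1 := by positivity
    have hn2 : (0 : ℝ) < n + 2 := by positivity
    obtain ⟨u, hu, rfl⟩ : ∃ u, |u| ≤ 1 ∧ t = x / (n + 2) + u :=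
      ⟨t - x / (n + 2), by rw [abs_le]; constructor <;> linarith [ht.1, ht.2], by ring⟩
    set a := |x| / ((n : ℝ) + 2) with ha
    have ha0 : 0 ≤ a := by positivity
    have habs : |x / ((n : ℝ) + 2)| = a := by rw [abs_div, abs_of_pos hn2]
    have h1 : |x / (n + 2) + u| ^ α ≤ (a + 1) ^ α := by
      refine Real.rpow_le_rpow (abs_nonneg _) ?_ hα.le
      have := abs_add_le (x / ((n : ℝ) + 2)) u
      rw [habs] at this
      linarith
    have h2 : splitCost α n (x - (x / (n + 2) + u)) ≤ (n + 1) * (a + 1) ^ α := by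
      unfold splitCost
      gcongr
      rw [div_le_iff₀ hn]
      have e : x - (x / (n + 2) + u) = (n + 1) * (x / (n + 2)) - u := by field_simp; ring
      have := abs_sub ((n + 1) * (x / ((n : ℝ) + 2))) u
      rw [abs_mul, habs, abs_of_pos hn] at this
      rw [e]
      nlinarith
    have h3 : splitCost α (n + 1) x = (n + 2) * a ^ α := by
      rw [splitCost, ha]; push_cast; ring_nf
    have h4 := hK a ha0
    have h5 : b' * (|x / (n + 2) + u| ^ α + splitCost α n (x - (x / (n + 2) + u)))
        ≤ b' * ((n + 2) * K) + b * splitCost α (n + 1) x := by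
      calc b' * (|x / (n + 2) + u| ^ α + splitCost α n (x - (x / (n + 2) + u)))
          ≤ b' * ((a + 1) ^ α + (n + 1) * (a + 1) ^ α) := by gcongr
        _ = b' * ((n + 2) * (a + 1) ^ α) := by ring
        _ ≤ b' * ((n + 2) * (b / b' * a ^ α + K)) := by gcongr
        _ = _ := by rw [h3]; field_simp; ring
    calc c * Real.exp (-(b' * ((n + 2) * K))) * Real.exp (-(b * splitCost α (n + 1) x))
        = c * Real.exp (-(b' * ((n + 2) * K) + b * splitCost α (n + 1) x)) := by
          rw [mul_assoc, ← Real.exp_add]; ring_nf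
      _ ≤ c * Real.exp (-(b' * (|x / (n + 2) + u| ^ α
            + splitCost α n (x - (x / (n + 2) + u))))) := by gcongr
      _ = Real.exp (-(b' * |x / (n + 2) + u| ^ α))
            * (c * Real.exp (-(b' * splitCost α n (x - (x / (n + 2) + u))))) := by
          rw [mul_add, neg_add, Real.exp_add]; ring
      _ ≤ stableChar α (x / (n + 2) + u) * stableConv α n 0 (x - (x / (n + 2) + u)) := by
          refine mul_le_mul ?_ (h _) (by positivity) (stableChar_pos _ _).le
          rw [stableChar, Real.exp_le_exp]
          nlinarith [Real.rpow_nonneg (abs_nonneg (x / (n + 2) + u)) α]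

lemma exists_abs_realConv_le_exp {α b b' A C : ℝ} (hα : 1 ≤ α) (hb : 0 ≤ b) (hbb : b < b') {n : ℕ}
    {f g : ℝ → ℝ} (hA : 0 ≤ A) (hC : 0 ≤ C) (hf : ∀ t, |f t| ≤ A * Real.exp (-(b' * |t| ^ α)))
    (hg : ∀ t, |g t| ≤ C * Real.exp (-(b' * splitCost α n t))) :
    ∃ D ≥ 0, ∀ x, |realConv f g x| ≤ D * Real.exp (-(b * splitCost α (n + 1) x)) := by
  have hi := integrable_exp_neg_mul_abs_rpow (zero_lt_one.trans_le hα) (sub_pos.2 hbb)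
  refine ⟨A * C * ∫ t, Real.exp (-(b' - b) * |t| ^ α),
    mul_nonneg (mul_nonneg hA hC) (integral_nonneg fun t => (Real.exp_pos _).le), fun x => ?_⟩
  rw [← integral_const_mul, ← integral_mul_const, ← Real.norm_eq_abs]
  refine norm_integral_le_of_norm_le ((hi.const_mul _).mul_const _)
    (Eventually.of_forall fun t => ?_)
  rw [Real.norm_eq_abs, abs_mul]
  calc |f t| * |g (x - t)|
      ≤ (A * Real.exp (-(b' * |t| ^ α))) * (C * Real.exp (-(b' * splitCost α n (x - t)))) := by
        gcongr
        · exact hf t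
        · exact hg _
    _ = A * C * Real.exp (-(b' * |t| ^ α) - b' * splitCost α n (x - t)) := by
        rw [sub_eq_add_neg (-_), Real.exp_add]; ring
    _ ≤ A * C * Real.exp (-(b' - b) * |t| ^ α - b * splitCost α (n + 1) x) := by
        refine mul_le_mul_of_nonneg_left (Real.exp_le_exp.2 ?_) (mul_nonneg hA hC)
        have h1 := mul_le_mul_of_nonneg_left (splitCost_succ_le hα n x t) hb
        have h2 := mul_le_mul_of_nonneg_right hbb.le (splitCost_nonneg α n (x - t))
        linarith
    _ = _ := by rw [sub_eq_add_neg (_ * _), Real.exp_add]; ring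

lemma exists_abs_stableConv_le_exp {α b : ℝ} (hα : 1 ≤ α) (hb : 0 ≤ b) (hb1 : b < 1) (n j : ℕ) :
    ∃ C ≥ 0, ∀ x, |stableConv α n j x| ≤ C * Real.exp (-(b * splitCost α n x)) := by
  have hq {b : ℝ} (hb1 : b < 1) (x : ℝ) :
      |stableChar α x| ≤ 1 * Real.exp (-(b * |x| ^ α)) := by
    rw [one_mul, abs_of_pos (stableChar_pos α x), stableChar, Real.exp_le_exp]
    nlinarith [Real.rpow_nonneg (abs_nonneg x) α]
  have hd {b : ℝ} (hb : 0 ≤ b) (hb1 : b < 1) (x : ℝ) :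
      |stableCharDeriv α x| ≤ α * (1 - b)⁻¹ * Real.exp (-(b * |x| ^ α)) := by
    simpa using abs_stableCharDeriv_le_exp hα (sub_pos.2 hb1) (by linarith) x
  have hdn {b : ℝ} (hb1 : b < 1) : 0 ≤ α * (1 - b)⁻¹ :=
    mul_nonneg (by linarith) (inv_nonneg.2 (by linarith))
  induction n generalizing b j with
  | zero =>
    simp only [splitCost_zero]
    cases j with
    | zero => exact ⟨1, zero_le_one, hq hb1⟩
    | succ j => exact ⟨_, hdn hb1, hd hb hb1⟩
  | succ n ih =>
    obtain ⟨b', hbb, hb'⟩ := exists_between hb1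
    cases j with
    | zero =>
      obtain ⟨C, hC0, hC⟩ := ih (hb.trans hbb.le) hb' 0
      exact exists_abs_realConv_le_exp hα hb hbb zero_le_one hC0 (hq hb') hC
    | succ j =>
      obtain ⟨C, hC0, hC⟩ := ih (hb.trans hbb.le) hb' j
      exact exists_abs_realConv_le_exp hα hb hbb (hdn hb') hC0 (hd (hb.trans hbb.le) hb') hC

/-! ### Comparing the convolutions with their lowest-order member -/

lemma stableConv_pos {α : ℝ} (hα : 0 < α) (n : ℕ) (x : ℝ) : 0 < stableConv α n 0 x := by
  obtain ⟨c, hc, h⟩ := exists_mul_exp_le_stableConv hα one_lt_two n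
  exact lt_of_lt_of_le (by positivity) (h x)

lemma exists_stableConv_comparison_of_le_one {α : ℝ} (hα : 0 < α) (hα1 : α ≤ 1) {n ℓ : ℕ}
    (hb : ∀ j ≤ ℓ, ∃ C, ∀ x, |stableConv α n j x| ≤ C * stableConv α n 0 x) :
    ∃ E : ℝ → ℝ, (∀ x, 1 ≤ E x) ∧
      (∀ j ≤ ℓ, ∃ C, ∀ x, |stableConv α n j x| ≤ C * stableConv α n 0 x * E x) ∧
      ∃ C, ∀ x, E x ^ ℓ ≤ C * (stableConv α n 0 x * Real.exp (|x| ^ α)) := by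
  refine ⟨fun _ => 1, fun _ => le_rfl, by simpa using hb, ?_⟩
  obtain ⟨c, hc, h⟩ := exists_mul_stableChar_le_stableConv hα hα1 n
  refine ⟨c⁻¹, fun x => ?_⟩
  rw [one_pow, le_inv_mul_iff₀ hc, mul_one]
  calc c = c * stableChar α x * Real.exp (|x| ^ α) := by
        rw [stableChar, mul_assoc, ← Real.exp_add]; simp
    _ ≤ _ := by gcongr; exact h x

lemma exists_stableConv_comparison_of_one_lt {α : ℝ} (hα : 1 < α) {n : ℕ} (hn : 1 ≤ n) (ℓ : ℕ) :
    ∃ E : ℝ → ℝ, (∀ x, 1 ≤ E x) ∧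
      (∀ j ≤ ℓ, ∃ C, ∀ x, |stableConv α n j x| ≤ C * stableConv α n 0 x * E x) ∧
      ∃ C, ∀ x, E x ^ ℓ ≤ C * (stableConv α n 0 x * Real.exp (|x| ^ α)) := by
  set θ : ℝ := ((n : ℝ) + 1) ^ (1 - α) with hθ
  have hn1 : (1 : ℝ) < n + 1 := by
    have : (1 : ℝ) ≤ n := by exact_mod_cast hn
    linarith
  have hθ0 : 0 < θ := by positivity
  have hθ1 : θ < 1 := Real.rpow_lt_one_of_one_lt_of_neg hn1 (by linarith)
  set M : ℝ := 2 * ℓ + 1 with hM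
  have hM0 : 0 < M := by positivity
  obtain ⟨ε, hε0, hε⟩ : ∃ ε, 0 < ε ∧ (ε < 1 ∧ (1 + M * ε) * θ ≤ 1) := by
    refine ⟨(1 - θ) / M, by have := sub_pos.2 hθ1; positivity, ?_, ?_⟩
    · rw [div_lt_one hM0, hM]
      have : (0 : ℝ) ≤ ℓ := by positivity
      linarith
    · rw [mul_div_cancel₀ _ hM0.ne']
      nlinarith [sq_nonneg (1 - θ)]
  obtain ⟨c, hc, hlow⟩ := exists_mul_exp_le_stableConv (zero_lt_one.trans hα)
    (by linarith : (1 : ℝ) < 1 + ε) n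
  refine ⟨fun x => Real.exp (2 * ε * splitCost α n x), fun x => ?_, fun j _ => ?_, c⁻¹,
    fun x => ?_⟩
  · exact Real.one_le_exp (mul_nonneg (by linarith) (splitCost_nonneg α n x))
  · obtain ⟨C, hC0, hC⟩ := exists_abs_stableConv_le_exp hα.le (by linarith : 0 ≤ 1 - ε)
      (by linarith) n j
    refine ⟨C * c⁻¹, fun x => (hC x).trans ?_⟩
    calc C * Real.exp (-((1 - ε) * splitCost α n x))
        = C * c⁻¹ * (c * Real.exp (-((1 + ε) * splitCost α n x)))
            * Real.exp (2 * ε * splitCost α n x) := by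
          have e : -((1 - ε) * splitCost α n x)
            = -((1 + ε) * splitCost α n x) + 2 * ε * splitCost α n x := by ring
          rw [e, Real.exp_add]
          field_simp
      _ ≤ _ := by gcongr; exact hlow x
  · rw [le_inv_mul_iff₀ hc, ← Real.exp_nat_mul]
    calc c * Real.exp (ℓ * (2 * ε * splitCost α n x))
        = c * Real.exp (-((1 + ε) * splitCost α n x))
            * Real.exp ((1 + M * ε) * splitCost α n x) := by
          rw [mul_assoc c, ← Real.exp_add, hM]; ring_nf
      _ ≤ c * Real.exp (-((1 + ε) * splitCost α n x)) * Real.exp (|x| ^ α) := by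
          gcongr
          rw [splitCost_eq, ← mul_assoc]
          exact mul_le_of_le_one_left (by positivity) hε.2
      _ ≤ _ := by gcongr; exact hlow x

lemma exists_stableConv_comparison {α : ℝ} (hα : 0 < α) {n ℓ : ℕ} (hn : 1 ≤ n)
    (hℓ : (α < 1 ∧ ℓ ≤ n) ∨ 1 ≤ α) :
    ∃ E : ℝ → ℝ, (∀ x, 1 ≤ E x) ∧
      (∀ j ≤ ℓ, ∃ C, ∀ x, |stableConv α n j x| ≤ C * stableConv α n 0 x * E x) ∧
      ∃ C, ∀ x, E x ^ ℓ ≤ C * (stableConv α n 0 x * Real.exp (|x| ^ α)) := by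
  rcases hℓ with ⟨hα1, hℓ⟩ | hα1
  · refine exists_stableConv_comparison_of_le_one hα hα1.le fun j hj => ?_
    obtain ⟨C, hC⟩ := exists_abs_stableConv_le_stableChar hα hα1 (hj.trans hℓ)
    obtain ⟨c, hc, h⟩ := exists_mul_stableChar_le_stableConv hα hα1.le n
    have hC0 : 0 ≤ C := by
      have h1 := (abs_nonneg _).trans (hC 0)
      exact nonneg_of_mul_nonneg_left h1 (stableChar_pos α 0)
    refine ⟨C * c⁻¹, fun x => (hC x).trans ?_⟩
    calc C * stableChar α x = C * c⁻¹ * (c * stableChar α x) := by field_simp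
      _ ≤ _ := by gcongr; exact h x
  · rcases hα1.eq_or_lt with rfl | hα1
    · exact exists_stableConv_comparison_of_le_one one_pos le_rfl fun j _ =>
        ⟨1, fun x => by simpa using abs_stableConv_one_le n j x⟩
    · exact exists_stableConv_comparison_of_one_lt hα1 hn ℓ

/-! ### Fourier inversion -/

open scoped FourierTransform

/-- The cosine transform of `stableChar α`. -/
def stableCosTransform (α ω : ℝ) : ℝ := ∫ t, Real.cos (ω * t) * stableChar α t

lemma integral_exp_mul_stableChar {α : ℝ} (hα : 0 < α) (ω : ℝ) :
    ∫ t : ℝ, Complex.exp (-(Complex.I * (t : ℂ) * (ω : ℂ))) * (stableChar α t : ℂ)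
      = (stableCosTransform α ω : ℂ) := by
  have hq := integrable_stableChar hα
  have hc : Integrable fun t => Real.cos (ω * t) * stableChar α t :=
    hq.bdd_mul (c := 1) (by fun_prop) (Eventually.of_forall fun t => Real.abs_cos_le_one _)
  have hs : Integrable fun t => Real.sin (ω * t) * stableChar α t :=
    hq.bdd_mul (c := 1) (by fun_prop) (Eventually.of_forall fun t => Real.abs_sin_le_one _)
  have hs0 : ∫ t, Real.sin (ω * t) * stableChar α t = 0 := by
    have h := integral_neg_eq_self (fun t => Real.sin (ω * t) * stableChar α t) volume
    simp only [mul_neg, Real.sin_neg, neg_mul, stableChar, abs_neg] at h ⊢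
    rw [integral_neg] at h
    linarith
  have hpt : ∀ t : ℝ, Complex.exp (-(Complex.I * (t : ℂ) * (ω : ℂ))) * (stableChar α t : ℂ)
      = ((Real.cos (ω * t) * stableChar α t : ℝ) : ℂ)
        - Complex.I * ((Real.sin (ω * t) * stableChar α t : ℝ) : ℂ) := by
    intro t
    rw [show -(Complex.I * (t : ℂ) * (ω : ℂ)) = ((-(ω * t) : ℝ) : ℂ) * Complex.I by
      push_cast; ring, Complex.exp_mul_I, ← Complex.ofReal_cos, ← Complex.ofReal_sin,
      Real.cos_neg, Real.sin_neg]
    push_cast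
    ring
  simp_rw [hpt]
  rw [integral_sub hc.ofReal (hs.ofReal.const_mul _), integral_const_mul, integral_complex_ofReal,
    integral_complex_ofReal, hs0, stableCosTransform]
  simp

lemma continuous_stableCosTransform {α : ℝ} (hα : 0 < α) : Continuous (stableCosTransform α) := by
  refine continuous_of_dominated (bound := stableChar α) (fun ω => ?_) (fun ω => ?_)
    (integrable_stableChar hα) (Eventually.of_forall fun t => by fun_prop)
  · exact (Continuous.mul (by fun_prop) (continuous_stableChar hα)).aestronglyMeasurable
  · refine Eventually.of_forall fun t => ?_
    rw [norm_mul, Real.norm_eq_abs, Real.norm_eq_abs, abs_of_pos (stableChar_pos α t)]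
    exact mul_le_of_le_one_left (stableChar_pos α t).le (Real.abs_cos_le_one _)

lemma abs_stableCosTransform_le {α : ℝ} (hα : 0 < α) (ω : ℝ) :
    |stableCosTransform α ω| ≤ ∫ t, stableChar α t := by
  rw [← Real.norm_eq_abs]
  refine norm_integral_le_of_norm_le (integrable_stableChar hα) (Eventually.of_forall fun t => ?_)
  rw [norm_mul, Real.norm_eq_abs, Real.norm_eq_abs, abs_of_pos (stableChar_pos α t)]
  exact mul_le_of_le_one_left (stableChar_pos α t).le (Real.abs_cos_le_one _)

lemma tendsto_stableChar_atTop {α : ℝ} (hα : 0 < α) : Tendsto (stableChar α) atTop (nhds 0) :=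
  Real.tendsto_exp_neg_atTop_nhds_zero.comp
    ((tendsto_rpow_atTop hα).comp tendsto_abs_atTop_atTop)

lemma abs_mul_stableCosTransform_le {α : ℝ} (hα : 0 < α) (ω : ℝ) :
    |ω * stableCosTransform α ω| ≤ 2 * ∫ t, |stableCharDeriv α t| := by
  have habs : stableCosTransform α ω
      = 2 * ∫ t in Set.Ioi (0 : ℝ), Real.cos (ω * t) * stableChar α t := by
    rw [← integral_comp_abs (f := fun t => Real.cos (ω * t) * stableChar α t)]
    refine integral_congr_ae (Eventually.of_forall fun t => ?_)
    have h1 : Real.cos (ω * |t|) = Real.cos (ω * t) := by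
      rw [← Real.cos_abs, abs_mul, abs_abs, ← abs_mul, Real.cos_abs]
    simp [h1, stableChar]
  have hq := integrable_stableChar hα
  have hd := integrable_stableCharDeriv hα
  have hparts := integral_Ioi_mul_deriv_eq_deriv_mul (a := (0 : ℝ)) (a' := (0 : ℝ)) (b' := 0)
    (u := stableChar α) (v := fun t => Real.sin (ω * t)) (u' := stableCharDeriv α)
    (v' := fun t => Real.cos (ω * t) * ω) (fun t ht => hasDerivAt_stableChar α (ne_of_gt ht))
    (fun t _ => by simpa using ((hasDerivAt_id t).const_mul ω).sin)
    (Integrable.integrableOn (hq.mul_bdd (c := |ω|) (by fun_prop)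
      (Eventually.of_forall fun t => by
        rw [norm_mul, Real.norm_eq_abs, Real.norm_eq_abs]
        exact mul_le_of_le_one_left (abs_nonneg ω) (Real.abs_cos_le_one _))))
    (Integrable.integrableOn (hd.mul_bdd (c := 1) (by fun_prop)
      (Eventually.of_forall fun t => Real.abs_sin_le_one _)))
    (by
      have : Continuous (stableChar α * fun t => Real.sin (ω * t)) :=
        (continuous_stableChar hα).mul (by fun_prop)
      simpa using (this.tendsto 0).mono_left nhdsWithin_le_nhds)
    ((tendsto_stableChar_atTop hα).zero_mul_isBoundedUnder_le
      (isBoundedUnder_of ⟨1, fun t => Real.abs_sin_le_one _⟩))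
  have hω : ω * stableCosTransform α ω
      = -(2 * ∫ t in Set.Ioi (0 : ℝ), stableCharDeriv α t * Real.sin (ω * t)) := by
    rw [habs, show ω * (2 * ∫ t in Set.Ioi (0 : ℝ), Real.cos (ω * t) * stableChar α t)
      = 2 * (ω * ∫ t in Set.Ioi (0 : ℝ), Real.cos (ω * t) * stableChar α t) by ring,
      ← integral_const_mul]
    have e : ∀ t, ω * (Real.cos (ω * t) * stableChar α t)
      = stableChar α t * (Real.cos (ω * t) * ω) := fun t => by ring
    simp_rw [e]
    rw [hparts]
    ring
  rw [hω, abs_neg, abs_mul, abs_two]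
  gcongr
  rw [← Real.norm_eq_abs]
  refine (norm_integral_le_of_norm_le hd.abs.integrableOn (Eventually.of_forall fun t => ?_)).trans
    (setIntegral_le_integral hd.abs (Eventually.of_forall fun t => abs_nonneg _))
  rw [norm_mul]
  exact mul_le_of_le_one_right (abs_nonneg _) (Real.abs_sin_le_one _)

lemma integrable_stableCosTransform_pow {α : ℝ} (hα : 0 < α) {n : ℕ} (hn : 1 ≤ n) :
    Integrable fun ω => stableCosTransform α ω ^ (n + 1) := by
  set A := ∫ t, stableChar α t
  set B := 2 * ∫ t, |stableCharDeriv α t|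
  refine (integrable_inv_one_add_sq.const_mul (A ^ (n - 1) * (A ^ 2 + B ^ 2))).mono'
    ((continuous_stableCosTransform hα).pow _).aestronglyMeasurable
    (Eventually.of_forall fun ω => ?_)
  have hA := abs_stableCosTransform_le hα ω
  have hB := abs_mul_stableCosTransform_le hα ω
  have hA0 : 0 ≤ A := (abs_nonneg _).trans hA
  have h2 : |stableCosTransform α ω| ^ 2 ≤ (A ^ 2 + B ^ 2) * (1 + ω ^ 2)⁻¹ := by
    rw [← div_eq_mul_inv, le_div_iff₀ (by positivity)]
    have h3 := pow_le_pow_left₀ (abs_nonneg _) hA 2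
    have h4 := pow_le_pow_left₀ (abs_nonneg _) hB 2
    rw [sq_abs] at h3 h4 ⊢
    nlinarith
  obtain ⟨m, rfl⟩ : ∃ m, n = m + 1 := ⟨n - 1, by omega⟩
  rw [norm_pow, Real.norm_eq_abs, show m + 1 + 1 = m + 2 from rfl, pow_add, mul_assoc,
    Nat.add_sub_cancel]
  gcongr

lemma ofReal_realConv (f g : ℝ → ℝ) : (fun x => (realConv f g x : ℂ))
    = convolution (fun t => (f t : ℂ)) (fun t => (g t : ℂ)) (ContinuousLinearMap.mul ℂ ℂ)
      volume := by
  ext x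
  rw [convolution_mul, realConv, ← integral_complex_ofReal]
  simp

lemma fourier_stableChar {α : ℝ} (hα : 0 < α) (ξ : ℝ) :
    𝓕 (fun t => (stableChar α t : ℂ)) ξ = stableCosTransform α (2 * Real.pi * ξ) := by
  rw [Real.fourier_real_eq_integral_exp_smul, ← integral_exp_mul_stableChar hα]
  refine integral_congr_ae (Eventually.of_forall fun t => ?_)
  simp only [smul_eq_mul]
  push_cast
  ring_nf

lemma fourier_stableConv {α : ℝ} (hα : 0 < α) (n : ℕ) (ξ : ℝ) :
    𝓕 (fun t => (stableConv α n 0 t : ℂ)) ξ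
      = (stableCosTransform α (2 * Real.pi * ξ) : ℂ) ^ (n + 1) := by
  induction n with
  | zero => simpa [stableConv] using fourier_stableChar hα ξ
  | succ n ih =>
    simp only [stableConv]
    have h := Real.fourier_mul_convolution_eq (R := ℂ) (f₁ := fun t => (stableChar α t : ℂ))
      (f₂ := fun t => (stableConv α n 0 t : ℂ)) (integrable_stableChar hα).ofReal
      (integrable_stableConv hα n 0).ofReal ξ
    rw [ih, fourier_stableChar hα] at h
    rw [ofReal_realConv]
    refine h.trans ?_
    ring

lemma integral_exp_mul_stableCosTransform_pow {α : ℝ} (hα : 0 < α) {n : ℕ} (hn : 1 ≤ n) (w : ℝ) :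
    ∫ t : ℝ, Complex.exp (Complex.I * (w : ℂ) * (t : ℂ)) * (stableCosTransform α t : ℂ) ^ (n + 1)
      = 2 * Real.pi * stableConv α n 0 w := by
  have hpi : (0 : ℝ) < 2 * Real.pi := by positivity
  have hF : 𝓕 (fun t => (stableConv α n 0 t : ℂ))
      = fun ξ => ((stableCosTransform α (2 * Real.pi * ξ) ^ (n + 1) : ℝ) : ℂ) := by
    ext ξ
    rw [fourier_stableConv hα]
    push_cast
    rfl
  have hInt : Integrable (𝓕 fun t => (stableConv α n 0 t : ℂ)) := by
    rw [hF]
    exact ((integrable_stableCosTransform_pow hα hn).comp_mul_left' hpi.ne').ofReal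
  have hinv : 𝓕⁻ (𝓕 fun t => (stableConv α n 0 t : ℂ)) = fun t => (stableConv α n 0 t : ℂ) :=
    Continuous.fourierInv_fourier_eq
      (Complex.continuous_ofReal.comp (continuous_stableConv hα (Nat.zero_le n)))
    (integrable_stableConv hα n 0).ofReal hInt
  have hw := congrFun hinv w
  rw [hF, Real.fourierInv_eq'] at hw
  have hsub := Measure.integral_comp_mul_left (fun t : ℝ => Complex.exp
    (Complex.I * (w : ℂ) * (t : ℂ)) * (stableCosTransform α t : ℂ) ^ (n + 1)) (2 * Real.pi)
  have heq : ∀ v : ℝ, Complex.exp (((2 * Real.pi * inner ℝ v w : ℝ) : ℂ) * Complex.I)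
        • ((stableCosTransform α (2 * Real.pi * v) ^ (n + 1) : ℝ) : ℂ)
      = Complex.exp (Complex.I * (w : ℂ) * ((2 * Real.pi * v : ℝ) : ℂ))
        * (stableCosTransform α (2 * Real.pi * v) : ℂ) ^ (n + 1) := by
    intro v
    simp only [smul_eq_mul, RCLike.inner_apply, conj_trivial]
    push_cast
    ring_nf
  simp_rw [heq] at hw
  rw [hsub, abs_of_pos (inv_pos.2 hpi), Complex.real_smul] at hw
  rw [← hw]
  have : (Real.pi : ℂ) ≠ 0 := by exact_mod_cast Real.pi_ne_zero
  push_cast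
  field_simp

lemma exists_rfun_eq {α : ℝ} (hα : 0 < α) {n : ℕ} (hn : 1 ≤ n) :
    ∃ A : ℂ, rfun α (n + 1) = fun x => A * (stableConv α n 0 x : ℂ)⁻¹ := by
  have hs (x : ℝ) : salpha α x = 1 / (2 * Real.pi) * stableCosTransform α x := by
    have h := integral_exp_mul_stableChar hα x
    simp only [stableChar] at h
    rw [salpha, h, Complex.ofReal_re]
  set Z := ∫ t, salpha α t ^ (n + 1)
  refine ⟨((1 / (2 * Real.pi)) ^ (n + 1) / (Z : ℂ) * (2 * Real.pi))⁻¹, funext fun w => ?_⟩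
  have hft : ftC (falphak α (n + 1)) w
      = (1 / (2 * Real.pi)) ^ (n + 1) / (Z : ℂ) * (2 * Real.pi * stableConv α n 0 w) := by
    rw [← integral_exp_mul_stableCosTransform_pow hα hn, ← integral_const_mul, ftC]
    refine integral_congr_ae (Eventually.of_forall fun t => ?_)
    simp only [falphak, hs t]
    push_cast
    ring
  rw [rfun, hft, one_div, ← mul_assoc, mul_inv]

/-- Upper bound `|r_{α,k}^{(ℓ)}(x)| ≤ K_{α,ℓ} exp(|x|^α)`, for `ℓ ≤ k-1` when
`α ∈ (0,1)` and for `ℓ ≤ k` when `α ∈ [1,2)`. -/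
theorem rfun_deriv_bound (α : ℝ) (hα : α ∈ Set.Ioo (0 : ℝ) 2) (k : ℕ) (hk : 2 ≤ k)
    (ℓ : ℕ) (hℓ : (α < 1 ∧ ℓ ≤ k - 1) ∨ (1 ≤ α ∧ ℓ ≤ k)) :
    ∃ K > (0 : ℝ), ∀ x : ℝ,
      ‖iteratedDeriv ℓ (rfun α k) x‖ ≤ K * Real.exp (|x| ^ α) := by
  obtain ⟨m, rfl⟩ : ∃ m, k = m + 1 + 1 := ⟨k - 2, by omega⟩
  have hα0 : 0 < α := hα.1
  have hn : 1 ≤ m + 1 := by omega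
  obtain ⟨A, hA⟩ := exists_rfun_eq hα0 hn
  obtain ⟨E, hE1, hEb, C, hC⟩ := exists_stableConv_comparison (ℓ := ℓ) hα0 hn
    (hℓ.imp (fun h => ⟨h.1, by omega⟩) fun h => h.1)
  have hcont (j : ℕ) (hj : j ≤ ℓ) : Continuous (stableConv α (m + 1) j) := by
    rcases Nat.lt_or_ge (m + 1) j with h | h
    · obtain rfl : j = m + 2 := by omega
      exact continuous_stableConv_top (hℓ.elim (fun h => by omega) fun h => h.1) m
    · exact continuous_stableConv hα0 h
  have hpos := stableConv_pos hα0 (m + 1)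
  obtain ⟨K, hK0, hK⟩ := exists_norm_iteratedDeriv_inv_le
    (V := fun j x => (stableConv α (m + 1) j x : ℂ)) (n := ℓ)
    (fun j hj x => ((isPrimitive_stableConv hα0 (by omega)).hasDerivAt
      (hcont (j + 1) hj) x).ofReal_comp)
    (Complex.continuous_ofReal.comp (hcont ℓ le_rfl))
    (fun x => Complex.ofReal_ne_zero.2 (hpos x).ne') hE1
    (fun j hj => by simpa [abs_of_pos (hpos _)] using hEb j hj) le_rfl
  refine ⟨‖A‖ * (K * C) + 1, ?_, fun x => ?_⟩
  · have hC0 : 0 < C := by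
      have h1 := (pow_pos (zero_lt_one.trans_le (hE1 0)) ℓ).trans_le (hC 0)
      exact pos_of_mul_pos_left h1 (mul_pos (hpos 0) (Real.exp_pos _)).le
    positivity
  · rw [hA, iteratedDeriv_const_mul_field, norm_mul, add_mul, mul_assoc]
    refine le_add_of_le_of_nonneg (mul_le_mul_of_nonneg_left ?_ (norm_nonneg A)) (by positivity)
    refine le_of_mul_le_mul_right ?_ (hpos x)
    have h := hK x
    rw [Complex.norm_real, Real.norm_eq_abs, abs_of_pos (hpos x)] at h
    calc _ ≤ K * E x ^ ℓ := h
      _ ≤ K * (C * (stableConv α (m + 1) 0 x * Real.exp (|x| ^ α))) := by gcongr; exact hC x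
      _ = _ := by ring

end
end

section
/- Let p ≥ 1, let m = ⌈p/2⌉, and let k(x) = c_p { (2m+2) sin(x/(2m+2)) / x }^{2m+2}, where c_p is chosen so that ∫_ℝ k(x) dx = 1. Then k is a symmetric probability density on ℝ with ∫ |u|^p k(u) du < ∞; its Fourier transform k* is supported in [−1,1], bounded by 1, and is ⌈p⌉ times differentiable with a Lipschitz ⌈p⌉-th derivative. -/
open MeasureTheory Filter

noncomputable section

/-- Unnormalized deconvolution kernel `{(2⌈p/2⌉+2) sin(x/(2⌈p/2⌉+2))/x}^{2⌈p/2⌉+2}`. -/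
def ker0 (p : ℝ) (x : ℝ) : ℝ :=
  ((2 * (⌈p / 2⌉₊ : ℝ) + 2) * Real.sin (x / (2 * (⌈p / 2⌉₊ : ℝ) + 2)) / x)
    ^ (2 * ⌈p / 2⌉₊ + 2)

/-- The deconvolution kernel `k`, normalized so that `∫ k = 1`. -/
def ker (p : ℝ) (x : ℝ) : ℝ := ker0 p x / ∫ y : ℝ, ker0 p y

open scoped FourierTransform

lemma ftC_eq_fourier (g : ℝ → ℝ) (w : ℝ) :
    ftC g w = 𝓕 (fun t : ℝ => (g t : ℂ)) (-(2 * Real.pi)⁻¹ * w) := by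
  rw [Real.fourier_real_eq_integral_exp_smul, ftC]
  congr 1 with t
  rw [smul_eq_mul]
  congr 2
  have : -2 * Real.pi * t * (-(2 * Real.pi)⁻¹ * w) = w * t := by
    field_simp
  rw [this]
  push_cast
  ring

lemma norm_exp_I_mul (w t : ℝ) : ‖Complex.exp (Complex.I * (w : ℂ) * (t : ℂ))‖ = 1 := by
  have : Complex.I * (w : ℂ) * (t : ℂ) = ((w * t : ℝ) : ℂ) * Complex.I := by push_cast; ring
  rw [this, Complex.norm_exp_ofReal_mul_I]

lemma MeasureTheory.Integrable.exp_mul_ofReal {g : ℝ → ℝ} (hg : Integrable g) (w : ℝ) :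
    Integrable fun t : ℝ => Complex.exp (Complex.I * (w : ℂ) * (t : ℂ)) * (g t : ℂ) := by
  refine hg.ofReal.bdd_mul (c := 1) (Continuous.aestronglyMeasurable (by fun_prop)) ?_
  exact .of_forall fun t => (norm_exp_I_mul w t).le

lemma norm_ftC_le (g : ℝ → ℝ) (w : ℝ) : ‖ftC g w‖ ≤ ∫ t, |g t| := by
  refine (norm_integral_le_integral_norm _).trans_eq ?_
  simp [norm_exp_I_mul]

lemma ftC_congr_ae {f g : ℝ → ℝ} (h : f =ᵐ[volume] g) : ftC f = ftC g := by
  ext w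
  refine integral_congr_ae ?_
  filter_upwards [h] with t ht
  rw [ht]

lemma ftC_const_mul (c : ℝ) (g : ℝ → ℝ) (w : ℝ) :
    ftC (fun t => c * g t) w = c * ftC g w := by
  rw [ftC, ftC, ← integral_const_mul]
  congr 1 with t
  push_cast
  ring

/-- Multiplication by `sin (a t)` turns into a symmetric difference of the Fourier transform. -/
lemma ftC_sin_mul {g : ℝ → ℝ} (hg : Integrable g) (a w : ℝ) :
    ftC (fun t => Real.sin (a * t) * g t) w =
      (Complex.I / 2) * (ftC g (w - a) - ftC g (w + a)) := by
  rw [ftC, ftC, ftC, ← integral_sub (hg.exp_mul_ofReal _) (hg.exp_mul_ofReal _),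
    ← integral_const_mul]
  congr 1 with t
  push_cast
  rw [Complex.sin]
  have h1 : Complex.exp (Complex.I * ((w : ℂ) - a) * t) =
      Complex.exp (Complex.I * w * t) * Complex.exp (-(a * t) * Complex.I) := by
    rw [← Complex.exp_add]; ring_nf
  have h2 : Complex.exp (Complex.I * ((w : ℂ) + a) * t) =
      Complex.exp (Complex.I * w * t) * Complex.exp ((a * t) * Complex.I) := by
    rw [← Complex.exp_add]; ring_nf
  rw [h1, h2]
  ring

lemma integral_exp_I_mul_eq_sinc (a t : ℝ) :
    ∫ s in -a..a, Complex.exp (Complex.I * (s : ℂ) * (t : ℂ)) =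
      2 * a * Real.sinc (a * t) := by
  by_cases ht : t = 0
  · simp [ht]; ring
  have h := intervalIntegral.integral_comp_mul_right
    (fun u : ℝ => Complex.exp (u * Complex.I)) (a := -a) (b := a) ht
  have h' : ∀ s : ℝ, Complex.I * (s : ℂ) * (t : ℂ) = ((s * t : ℝ) : ℂ) * Complex.I := by
    intro s; push_cast; ring
  simp_rw [h']
  rw [h, neg_mul, integral_exp_mul_I_eq_sinc, Complex.real_smul]
  push_cast
  have : (t : ℂ) ≠ 0 := by exact_mod_cast ht
  field_simp

/-- Multiplication by `sinc (a t)` turns into averaging the Fourier transform. -/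
lemma ftC_sinc_mul {g : ℝ → ℝ} (hg : Integrable g) {a : ℝ} (ha : 0 < a) (w : ℝ) :
    ftC (fun t => Real.sinc (a * t) * g t) w =
      (2 * a : ℂ)⁻¹ * ∫ s in -a..a, ftC g (w + s) := by
  have hint : Integrable (Function.uncurry fun (s t : ℝ) =>
      Complex.exp (Complex.I * ((w + s : ℝ) : ℂ) * (t : ℂ)) * (g t : ℂ))
      ((volume.restrict (Set.uIoc (-a) a)).prod volume) := by
    have : IsFiniteMeasure (volume.restrict (Set.uIoc (-a) a)) := by
      rw [Set.uIoc_of_le (by linarith)]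
      infer_instance
    have h1 : Integrable (fun z : ℝ × ℝ => (1 : ℂ) * (g z.2 : ℂ))
        ((volume.restrict (Set.uIoc (-a) a)).prod volume) :=
      Integrable.mul_prod (f := fun _ => (1 : ℂ)) (integrable_const _) hg.ofReal
    simp only [one_mul] at h1
    refine h1.bdd_mul (c := 1) (Continuous.aestronglyMeasurable (by fun_prop)) ?_
    exact .of_forall fun z => (norm_exp_I_mul _ _).le
  have hswap := intervalIntegral_integral_swap hint
  simp only [ftC] at hswap ⊢
  rw [hswap, ← integral_const_mul]
  congr 1 with t
  have h3 : ∀ s : ℝ, Complex.exp (Complex.I * ((w + s : ℝ) : ℂ) * (t : ℂ)) * (g t : ℂ) =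
      (Complex.exp (Complex.I * w * t) * g t) * Complex.exp (Complex.I * (s : ℂ) * (t : ℂ)) := by
    intro s
    have : Complex.I * ((w + s : ℝ) : ℂ) * (t : ℂ) =
      Complex.I * w * t + Complex.I * (s : ℂ) * (t : ℂ) := by push_cast; ring
    rw [this, Complex.exp_add]; ring
  simp_rw [h3]
  rw [intervalIntegral.integral_const_mul, integral_exp_I_mul_eq_sinc]
  have : (a : ℂ) ≠ 0 := by exact_mod_cast ha.ne'
  push_cast
  field_simp

/-- The Fourier transform of the triangle function. -/
lemma ftC_triangle {b t : ℝ} (hb : 0 < b) (ht : t ≠ 0) :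
    ftC (fun s => max 0 (b - |s|)) t = 4 * (Real.sin (b / 2 * t) / t) ^ 2 := by
  have hz : (Complex.I * t : ℂ) ≠ 0 := by simp [ht]
  set z : ℂ := Complex.I * t with hzdef
  have hexp : ∀ s : ℝ,
      HasDerivAt (fun s : ℝ => Complex.exp (z * s)) (Complex.exp (z * s) * z) s := by
    intro s
    have h1 : HasDerivAt (fun s : ℝ => z * (s : ℂ)) z s := by
      simpa using (Complex.ofRealCLM.hasDerivAt (x := s)).const_mul z
    exact h1.cexp
  have hid : ∀ s : ℝ, HasDerivAt (fun s : ℝ => (s : ℂ)) 1 s := fun s =>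
    Complex.ofRealCLM.hasDerivAt (x := s)
  have hright : ∫ s in (0 : ℝ)..b, Complex.exp (z * s) * ((b : ℂ) - s) =
      Complex.exp (z * b) / z ^ 2 - (b / z + 1 / z ^ 2) := by
    rw [intervalIntegral.integral_eq_sub_of_hasDerivAt
      (f := fun s : ℝ => ((b : ℂ) - s) * Complex.exp (z * s) / z + Complex.exp (z * s) / z ^ 2)
      (f' := fun s : ℝ => Complex.exp (z * s) * ((b : ℂ) - s))]
    · simp
    · intro s _
      have := ((((hid s).const_sub (b : ℂ)).mul (hexp s)).div_const z).add
        ((hexp s).div_const (z ^ 2))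
      refine this.congr_deriv ?_
      field_simp
      ring
    · exact Continuous.intervalIntegrable (by fun_prop) _ _
  have hleft : ∫ s in (-b)..(0 : ℝ), Complex.exp (z * s) * ((b : ℂ) + s) =
      b / z - 1 / z ^ 2 + Complex.exp (-(z * b)) / z ^ 2 := by
    rw [intervalIntegral.integral_eq_sub_of_hasDerivAt
      (f := fun s : ℝ => ((b : ℂ) + s) * Complex.exp (z * s) / z - Complex.exp (z * s) / z ^ 2)
      (f' := fun s : ℝ => Complex.exp (z * s) * ((b : ℂ) + s))]
    · simp
    · intro s _
      have := ((((hid s).const_add (b : ℂ)).mul (hexp s)).div_const z).sub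
        ((hexp s).div_const (z ^ 2))
      refine this.congr_deriv ?_
      field_simp
      ring
    · exact Continuous.intervalIntegrable (by fun_prop) _ _
  have hcut : ftC (fun s => max 0 (b - |s|)) t =
      ∫ s in -b..b, Complex.exp (z * s) * ((max 0 (b - |s|) : ℝ) : ℂ) := by
    rw [ftC, intervalIntegral.integral_of_le (by linarith),
      setIntegral_eq_integral_of_forall_compl_eq_zero]
    intro s hs
    have : b - |s| ≤ 0 := by
      by_contra hcon
      push Not at hcon
      have := abs_lt.1 (sub_pos.1 hcon)
      exact hs ⟨this.1, this.2.le⟩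
    rw [max_eq_left this]
    simp
  have hcont : Continuous fun s : ℝ => Complex.exp (z * s) * ((max 0 (b - |s|) : ℝ) : ℂ) := by
    fun_prop
  rw [hcut, ← intervalIntegral.integral_add_adjacent_intervals (b := 0)
    (hcont.intervalIntegrable _ _) (hcont.intervalIntegrable _ _)]
  have e1 : ∫ s in (-b)..(0 : ℝ), Complex.exp (z * s) * ((max 0 (b - |s|) : ℝ) : ℂ) =
      ∫ s in (-b)..(0 : ℝ), Complex.exp (z * s) * ((b : ℂ) + s) := by
    refine intervalIntegral.integral_congr fun s hs => ?_
    rw [Set.uIcc_of_le (by linarith)] at hs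
    rw [abs_of_nonpos hs.2, max_eq_right (by linarith [hs.1])]
    push_cast
    ring
  have e2 : ∫ s in (0 : ℝ)..b, Complex.exp (z * s) * ((max 0 (b - |s|) : ℝ) : ℂ) =
      ∫ s in (0 : ℝ)..b, Complex.exp (z * s) * ((b : ℂ) - s) := by
    refine intervalIntegral.integral_congr fun s hs => ?_
    rw [Set.uIcc_of_le (by linarith)] at hs
    rw [abs_of_nonneg hs.1, max_eq_right (by linarith [hs.2])]
    push_cast
    ring
  rw [e1, e2, hleft, hright]
  have htc : (t : ℂ) ≠ 0 := by exact_mod_cast ht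
  have hz2 : z ^ 2 = -(t : ℂ) ^ 2 := by rw [hzdef, mul_pow, Complex.I_sq]; ring
  have hsq : (Complex.sin (b / 2 * t)) ^ 2 =
      -(Complex.exp (z * b) + Complex.exp (-(z * b)) - 2) / 4 := by
    rw [Complex.sin]
    have h1 : Complex.exp (z * b) = Complex.exp (b / 2 * t * Complex.I) ^ 2 := by
      rw [← Complex.exp_nat_mul, hzdef]; push_cast; ring_nf
    have h2 : Complex.exp (-(z * b)) = Complex.exp (-(b / 2 * t) * Complex.I) ^ 2 := by
      rw [← Complex.exp_nat_mul, hzdef]; push_cast; ring_nf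
    have h3 : Complex.exp (b / 2 * t * Complex.I) * Complex.exp (-(b / 2 * t) * Complex.I) = 1 := by
      rw [← Complex.exp_add]; ring_nf; simp
    rw [h1, h2]
    generalize Complex.exp (b / 2 * t * Complex.I) = x at *
    generalize Complex.exp (-(b / 2 * t) * Complex.I) = y at *
    linear_combination ((y - x) ^ 2 / 4) * Complex.I_sq + (1 / 2 : ℂ) * h3
  push_cast
  rw [div_pow, hsq, hz2]
  field_simp
  ring

lemma mul_sinc_mul {a : ℝ} (ha : a ≠ 0) (t : ℝ) :
    t * Real.sinc (a * t) = a⁻¹ * Real.sin (a * t) := by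
  by_cases ht : t = 0
  · simp [ht]
  rw [Real.sinc_of_ne_zero (mul_ne_zero ha ht)]
  field_simp

lemma integrable_sinc_sq {a : ℝ} (ha : a ≠ 0) : Integrable fun t : ℝ => Real.sinc (a * t) ^ 2 := by
  refine (integrable_inv_one_add_sq.const_mul (1 + a⁻¹ ^ 2)).mono'
    (Continuous.aestronglyMeasurable (by fun_prop)) (.of_forall fun t => ?_)
  have h1 : Real.sinc (a * t) ^ 2 ≤ 1 := (sq_le_one_iff_abs_le_one _).2 (Real.abs_sinc_le_one _)
  have h2 : t ^ 2 * Real.sinc (a * t) ^ 2 ≤ a⁻¹ ^ 2 := by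
    rw [← mul_pow, mul_sinc_mul ha, mul_pow]
    exact mul_le_of_le_one_right (sq_nonneg _) (Real.sin_sq_le_one _)
  rw [Real.norm_of_nonneg (sq_nonneg _), ← div_eq_mul_inv, le_div_iff₀ (by positivity)]
  linarith

/-- The Fourier transform of the Fejér kernel is a triangle function. -/
lemma ftC_sinc_sq {a : ℝ} (ha : 0 < a) (w : ℝ) :
    ftC (fun t => Real.sinc (a * t) ^ 2) w =
      ((Real.pi / (2 * a ^ 2) * max 0 (2 * a - |w|) : ℝ) : ℂ) := by
  set f : ℝ → ℂ := fun s => ((max 0 (2 * a - |s|) : ℝ) : ℂ) with hf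
  have hcont : Continuous f := by fun_prop
  have hint : Integrable f := by
    refine hcont.integrable_of_hasCompactSupport
      (HasCompactSupport.intro (isCompact_Icc (a := -(2 * a)) (b := 2 * a)) fun s hs => ?_)
    have : 2 * a - |s| ≤ 0 := by
      by_contra hcon
      exact hs (abs_le.1 (by linarith))
    simp [hf, max_eq_left this]
  have hF : 𝓕 f =ᵐ[volume]
      fun ξ : ℝ => ((4 * a ^ 2 * Real.sinc (a * (2 * Real.pi * ξ)) ^ 2 : ℝ) : ℂ) := by
    filter_upwards [compl_mem_ae_iff.2 (measure_singleton (0 : ℝ))] with ξ hξ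
    have hξ0 : ξ ≠ 0 := hξ
    have ht : -(2 * Real.pi * ξ) ≠ 0 := neg_ne_zero.2 (mul_ne_zero (by positivity) hξ0)
    have h1 : 𝓕 f ξ = ftC (fun s => max 0 (2 * a - |s|)) (-(2 * Real.pi * ξ)) := by
      rw [ftC_eq_fourier]
      field_simp
      rfl
    rw [h1, ftC_triangle (by positivity) ht,
      Real.sinc_of_ne_zero (mul_ne_zero ha.ne' (neg_ne_zero.1 ht))]
    norm_cast
    rw [mul_div_cancel_left₀ a two_ne_zero, mul_neg, Real.sin_neg, neg_div_neg_eq]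
    field_simp
  have hFint : Integrable (𝓕 f) := by
    refine Integrable.congr ?_ hF.symm
    have := (integrable_sinc_sq (a := a * (2 * Real.pi)) (by positivity)).const_mul (4 * a ^ 2)
    simp only [mul_assoc a] at this
    exact this.ofReal
  have hinv := congrFun (hcont.fourierInv_fourier_eq hint hFint) w
  set G : ℝ → ℂ := fun t => Complex.exp (Complex.I * w * t) * ((Real.sinc (a * t) ^ 2 : ℝ) : ℂ)
    with hG
  have h2 : 𝓕⁻ (𝓕 f) w = ∫ ξ : ℝ, (4 * a ^ 2 : ℂ) * G (2 * Real.pi * ξ) := by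
    rw [Real.fourierInv_eq']
    refine integral_congr_ae ?_
    filter_upwards [hF] with ξ hξ
    rw [hξ, smul_eq_mul, hG]
    simp only [RCLike.inner_apply, conj_trivial]
    push_cast
    ring_nf
  rw [h2, integral_const_mul, Measure.integral_comp_mul_left G, abs_of_pos (by positivity),
    Complex.real_smul] at hinv
  change ∫ t, G t = _
  have hf' : ((max 0 (2 * a - |w|) : ℝ) : ℂ) = f w := rfl
  rw [Complex.ofReal_mul, hf', ← hinv]
  have h3 : (a : ℂ) ≠ 0 := by exact_mod_cast ha.ne'
  have h4 : (Real.pi : ℂ) ≠ 0 := by exact_mod_cast Real.pi_ne_zero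
  push_cast
  field_simp
  ring

lemma lipschitzWith_ftC_sinc_sq {a : ℝ} (ha : 0 < a) :
    ∃ L : NNReal, LipschitzWith L (ftC fun t => Real.sinc (a * t) ^ 2) := by
  refine ⟨Real.toNNReal (Real.pi / (2 * a ^ 2)), LipschitzWith.of_dist_le_mul fun x y => ?_⟩
  rw [ftC_sinc_sq ha, ftC_sinc_sq ha, Real.coe_toNNReal _ (by positivity), Complex.dist_eq,
    ← Complex.ofReal_sub, Complex.norm_real, ← mul_sub, norm_mul,
    Real.norm_of_nonneg (by positivity : 0 ≤ Real.pi / (2 * a ^ 2)), Real.dist_eq, Real.norm_eq_abs]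
  refine mul_le_mul_of_nonneg_left ?_ (by positivity)
  rw [max_comm 0, max_comm 0]
  refine (abs_max_sub_max_le_abs _ _ _).trans ?_
  rw [sub_sub_sub_cancel_left, abs_sub_comm x y]
  exact abs_abs_sub_abs_le_abs_sub y x

lemma lipschitzWith_ftC_sin_mul {g : ℝ → ℝ} (hg : Integrable g) (a : ℝ)
    (hL : ∃ L : NNReal, LipschitzWith L (ftC g)) :
    ∃ L : NNReal, LipschitzWith L (ftC fun t => Real.sin (a * t) * g t) := by
  obtain ⟨L, hL⟩ := hL
  refine ⟨L, LipschitzWith.of_dist_le_mul fun x y => ?_⟩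
  have h1 := hL.dist_le_mul (x - a) (y - a)
  have h2 := hL.dist_le_mul (x + a) (y + a)
  rw [dist_sub_right, dist_eq_norm] at h1
  rw [dist_add_right, dist_eq_norm] at h2
  rw [ftC_sin_mul hg, ftC_sin_mul hg, dist_eq_norm, ← mul_sub, norm_mul, sub_sub_sub_comm]
  have h3 : ‖Complex.I / 2‖ = 1 / 2 := by simp
  rw [h3]
  linarith [norm_sub_le (ftC g (x - a) - ftC g (y - a)) (ftC g (x + a) - ftC g (y + a))]

lemma lipschitzWith_ftC_sinc_mul {g : ℝ → ℝ} (hg : Integrable g) {a : ℝ} (ha : 0 < a)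
    (hL : ∃ L : NNReal, LipschitzWith L (ftC g)) :
    ∃ L : NNReal, LipschitzWith L (ftC fun t => Real.sinc (a * t) * g t) := by
  obtain ⟨L, hL⟩ := hL
  have hc := hL.continuous
  refine ⟨L, LipschitzWith.of_dist_le_mul fun x y => ?_⟩
  have h1 : ‖∫ s in -a..a, (ftC g (x + s) - ftC g (y + s))‖ ≤ L * dist x y * |a - -a| := by
    refine intervalIntegral.norm_integral_le_of_norm_le_const fun s _ => ?_
    have := hL.dist_le_mul (x + s) (y + s)
    rwa [dist_add_right, dist_eq_norm] at this
  rw [ftC_sinc_mul hg ha, ftC_sinc_mul hg ha, dist_eq_norm, ← mul_sub,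
    ← intervalIntegral.integral_sub (Continuous.intervalIntegrable (by fun_prop) _ _)
      (Continuous.intervalIntegrable (by fun_prop) _ _), norm_mul]
  have h3 : ‖(2 * a : ℂ)⁻¹‖ = (2 * a)⁻¹ := by simp [abs_of_pos ha]
  rw [h3, inv_mul_le_iff₀ (by positivity)]
  rw [abs_of_pos (by linarith)] at h1
  linarith

/-- The functions `sin (a t) ^ q * sinc (a t) ^ (j + 2)` are integrable. -/
lemma integrable_sin_pow_mul_sinc_pow {a : ℝ} (ha : a ≠ 0) (q j : ℕ) :
    Integrable fun t : ℝ => Real.sin (a * t) ^ q * Real.sinc (a * t) ^ (j + 2) := by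
  refine (integrable_sinc_sq ha).mono' (Continuous.aestronglyMeasurable (by fun_prop))
    (.of_forall fun t => ?_)
  rw [norm_mul, norm_pow, norm_pow, pow_add, ← mul_assoc, Real.norm_eq_abs, Real.norm_eq_abs,
    sq_abs]
  refine mul_le_of_le_one_left (sq_nonneg _) (mul_le_one₀ ?_ (by positivity) ?_)
  · exact pow_le_one₀ (abs_nonneg _) (Real.abs_sin_le_one _)
  · exact pow_le_one₀ (abs_nonneg _) (Real.abs_sinc_le_one _)

lemma integrable_sinc_pow {a : ℝ} (ha : a ≠ 0) (j : ℕ) :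
    Integrable fun t : ℝ => Real.sinc (a * t) ^ (j + 2) := by
  simpa using integrable_sin_pow_mul_sinc_pow ha 0 j

lemma lipschitzWith_ftC_sin_pow_mul_sinc_pow {a : ℝ} (ha : 0 < a) (q j : ℕ) :
    ∃ L : NNReal, LipschitzWith L
      (ftC fun t => Real.sin (a * t) ^ q * Real.sinc (a * t) ^ (j + 2)) := by
  induction q with
  | zero =>
    simp only [pow_zero, one_mul]
    induction j with
    | zero => exact lipschitzWith_ftC_sinc_sq ha
    | succ j ih =>
      convert lipschitzWith_ftC_sinc_mul (integrable_sinc_pow ha.ne' j) ha ih using 5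
      ring
  | succ q ih =>
    convert lipschitzWith_ftC_sin_mul (integrable_sin_pow_mul_sinc_pow ha.ne' q j) a ih using 5
    ring

lemma ftC_sinc_pow_eq_zero {a : ℝ} (ha : 0 < a) (j : ℕ) {w : ℝ} (hw : (j + 2) * a < |w|) :
    ftC (fun t => Real.sinc (a * t) ^ (j + 2)) w = 0 := by
  induction j generalizing w with
  | zero =>
    rw [zero_add, ftC_sinc_sq ha, max_eq_left (by norm_num at hw; linarith)]
    simp
  | succ j ih =>
    simp_rw [fun t : ℝ => show Real.sinc (a * t) ^ (j + 1 + 2) =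
      Real.sinc (a * t) * Real.sinc (a * t) ^ (j + 2) by ring]
    rw [ftC_sinc_mul (integrable_sinc_pow ha.ne' j) ha, mul_eq_zero]
    right
    refine intervalIntegral.integral_zero_ae (.of_forall fun s hs => ih ?_)
    rw [Set.uIoc_of_le (by linarith)] at hs
    have h1 : |s| ≤ a := abs_le.2 ⟨hs.1.le, hs.2⟩
    have h2 : |w| ≤ |w + s| + |s| := by simpa using abs_sub (w + s) s
    push_cast at hw
    linarith

lemma pow_mul_sinc_pow {a : ℝ} (ha : a ≠ 0) {q j : ℕ} (h : q ≤ j) (t : ℝ) :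
    t ^ q * Real.sinc (a * t) ^ (j + 2) =
      a⁻¹ ^ q * (Real.sin (a * t) ^ q * Real.sinc (a * t) ^ (j - q + 2)) := by
  obtain ⟨i, rfl⟩ := Nat.exists_eq_add_of_le h
  rw [Nat.add_sub_cancel_left, ← mul_assoc, ← mul_pow, ← mul_sinc_mul ha]
  ring

lemma integrable_pow_mul_sinc_pow {a : ℝ} (ha : a ≠ 0) {q j : ℕ} (h : q ≤ j) :
    Integrable fun t : ℝ => t ^ q * Real.sinc (a * t) ^ (j + 2) := by
  simp_rw [pow_mul_sinc_pow ha h]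
  exact (integrable_sin_pow_mul_sinc_pow ha _ _).const_mul _

section Differentiation

variable {g : ℝ → ℝ} {q : ℕ}

lemma contDiff_fourier_ofReal (hg : ∀ k ≤ q, Integrable fun t : ℝ => t ^ k * g t) :
    ContDiff ℝ q (𝓕 fun t : ℝ => (g t : ℂ)) := by
  refine Real.contDiff_fourier (N := q) fun k hk => ?_
  convert (hg k (by exact_mod_cast hk)).norm using 2 with t
  simp

lemma contDiff_ftC (hg : ∀ k ≤ q, Integrable fun t : ℝ => t ^ k * g t) :
    ContDiff ℝ q (ftC g) := by
  rw [funext (ftC_eq_fourier g)]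
  exact (contDiff_fourier_ofReal hg).comp (by fun_prop)

lemma iteratedDeriv_ftC (hg : ∀ k ≤ q, Integrable fun t : ℝ => t ^ k * g t) :
    iteratedDeriv q (ftC g) = fun w => Complex.I ^ q * ftC (fun t => t ^ q * g t) w := by
  have hD := Real.iteratedDeriv_fourier (f := fun t : ℝ => (g t : ℂ)) (N := q) (n := q)
    (fun k hk => by
      convert! (hg k (by exact_mod_cast hk)).ofReal (𝕜 := ℂ) using 2 with t
      simp) le_rfl
  rw [funext (ftC_eq_fourier g), iteratedDeriv_comp_const_smul (contDiff_fourier_ofReal hg), hD]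
  ext w
  rw [Real.fourier_real_eq_integral_exp_smul, ftC, ← integral_const_mul, ← integral_smul]
  congr 1 with t
  have h1 : -2 * Real.pi * t * (-(2 * Real.pi)⁻¹ * w) = w * t := by field_simp
  have h2 : (-2 * Real.pi * Complex.I * t : ℂ) ^ q =
      (((-(2 * Real.pi)) ^ q : ℝ) : ℂ) * (Complex.I ^ q * (t : ℂ) ^ q) := by
    push_cast
    rw [← mul_pow, ← mul_pow]
    ring
  have h3 : (((-(2 * Real.pi)⁻¹) ^ q : ℝ) : ℂ) * (((-(2 * Real.pi)) ^ q : ℝ) : ℂ) = 1 := by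
    norm_cast
    rw [← mul_pow, neg_mul_neg, inv_mul_cancel₀ (by positivity), one_pow]
  rw [h1, h2, Complex.real_smul, smul_eq_mul, smul_eq_mul,
    show ((w * t : ℝ) : ℂ) * Complex.I = Complex.I * w * t by push_cast; ring]
  push_cast at h3 ⊢
  linear_combination (Complex.exp (Complex.I * w * t) * Complex.I ^ q * t ^ q * g t) * h3

end Differentiation

lemma ker0_ae_eq (p : ℝ) : ker0 p =ᵐ[volume] fun t =>
    Real.sinc ((2 * (⌈p / 2⌉₊ : ℝ) + 2)⁻¹ * t) ^ (2 * ⌈p / 2⌉₊ + 2) := by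
  filter_upwards [compl_mem_ae_iff.2 (measure_singleton (0 : ℝ))] with t ht
  have ht0 : t ≠ 0 := ht
  have hn : (2 * (⌈p / 2⌉₊ : ℝ) + 2) ≠ 0 := by positivity
  rw [ker0, Real.sinc_of_ne_zero (mul_ne_zero (inv_ne_zero hn) ht0), inv_mul_eq_div]
  congr 1
  field_simp

lemma ker0_nonneg (p x : ℝ) : 0 ≤ ker0 p x :=
  Even.pow_nonneg ⟨⌈p / 2⌉₊ + 1, by ring⟩ _

lemma ker0_neg (p x : ℝ) : ker0 p (-x) = ker0 p x := by
  rw [ker0, ker0, neg_div, Real.sin_neg, mul_neg, neg_div_neg_eq]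

lemma integral_ker0_pos (p : ℝ) : 0 < ∫ y, ker0 p y := by
  rw [integral_congr_ae (ker0_ae_eq p)]
  refine integral_pos_of_integrable_nonneg_nonzero (x := 0) (by fun_prop)
    (integrable_sinc_pow (by positivity) _) (fun t => ?_) (by simp)
  exact Even.pow_nonneg ⟨⌈p / 2⌉₊ + 1, by ring⟩ _

lemma ker_ae_eq (p : ℝ) : ker p =ᵐ[volume] fun t => (∫ y, ker0 p y)⁻¹ *
    Real.sinc ((2 * (⌈p / 2⌉₊ : ℝ) + 2)⁻¹ * t) ^ (2 * ⌈p / 2⌉₊ + 2) := by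
  filter_upwards [ker0_ae_eq p] with t ht
  rw [_root_.ker, ht, div_eq_inv_mul]

lemma ker_nonneg (p x : ℝ) : 0 ≤ ker p x :=
  div_nonneg (ker0_nonneg p x) (integral_ker0_pos p).le

lemma integrable_pow_mul_ker (p : ℝ) {q : ℕ} (hq : q ≤ 2 * ⌈p / 2⌉₊) :
    Integrable fun t : ℝ => t ^ q * ker p t := by
  have h := (integrable_pow_mul_sinc_pow (a := (2 * (⌈p / 2⌉₊ : ℝ) + 2)⁻¹) (by positivity)
    hq).const_mul (∫ y, ker0 p y)⁻¹
  refine h.congr ?_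
  filter_upwards [ker_ae_eq p] with t ht
  rw [ht]
  ring

lemma integrable_ker (p : ℝ) : Integrable (ker p) := by
  simpa using integrable_pow_mul_ker p (Nat.zero_le _)

lemma integral_ker (p : ℝ) : ∫ x, ker p x = 1 := by
  simp_rw [_root_.ker]
  rw [integral_div, div_self (integral_ker0_pos p).ne']

lemma ceil_le_two_mul_ceil_half (p : ℝ) : ⌈p⌉₊ ≤ 2 * ⌈p / 2⌉₊ := by
  rw [Nat.ceil_le]
  push_cast
  linarith [Nat.le_ceil (p / 2)]

lemma integrable_abs_rpow_mul_ker {p : ℝ} (hp : 0 ≤ p) :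
    Integrable fun u : ℝ => |u| ^ p * ker p u := by
  have hq := (integrable_pow_mul_ker p (ceil_le_two_mul_ceil_half p)).norm
  refine ((integrable_ker p).add hq).mono' ?_ (.of_forall fun u => ?_)
  · exact (Continuous.aestronglyMeasurable (continuous_abs.rpow_const fun _ => .inr hp)).mul
      (integrable_ker p).1
  have hk := ker_nonneg p u
  have h1 : |u| ^ p ≤ 1 + |u| ^ ⌈p⌉₊ := by
    rcases le_total |u| 1 with h | h
    · linarith [Real.rpow_le_one (abs_nonneg u) h hp, pow_nonneg (abs_nonneg u) ⌈p⌉₊]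
    · have := Real.rpow_le_rpow_of_exponent_le h (Nat.le_ceil p)
      rw [Real.rpow_natCast] at this
      linarith
  rw [Real.norm_of_nonneg (by positivity), Pi.add_apply, norm_mul, norm_pow, Real.norm_eq_abs,
    Real.norm_of_nonneg hk]
  nlinarith

lemma ftC_ker_eq_zero (p : ℝ) {u : ℝ} (hu : 1 < |u|) : ftC (ker p) u = 0 := by
  rw [ftC_congr_ae (ker_ae_eq p), ftC_const_mul, ftC_sinc_pow_eq_zero (by positivity), mul_zero]
  push_cast
  rwa [mul_inv_cancel₀ (by positivity)]

lemma lipschitzWith_iteratedDeriv_ftC_ker (p : ℝ) {q : ℕ} (hq : q ≤ 2 * ⌈p / 2⌉₊) :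
    ∃ L : NNReal, LipschitzWith L (iteratedDeriv q (ftC (ker p))) := by
  set a : ℝ := (2 * (⌈p / 2⌉₊ : ℝ) + 2)⁻¹ with ha
  have hapos : 0 < a := by positivity
  obtain ⟨L, hL⟩ := lipschitzWith_ftC_sin_pow_mul_sinc_pow hapos q (2 * ⌈p / 2⌉₊ - q)
  have hae : (fun t => t ^ q * ker p t) =ᵐ[volume] fun t => ((∫ y, ker0 p y)⁻¹ * a⁻¹ ^ q) *
      (Real.sin (a * t) ^ q * Real.sinc (a * t) ^ (2 * ⌈p / 2⌉₊ - q + 2)) := by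
    filter_upwards [ker_ae_eq p] with t ht
    rw [ht, mul_left_comm, pow_mul_sinc_pow hapos.ne' hq, mul_assoc]
  rw [iteratedDeriv_ftC fun k hk => integrable_pow_mul_ker p (hk.trans hq), ftC_congr_ae hae]
  simp_rw [ftC_const_mul, ← mul_assoc, ← smul_eq_mul (_ * _) (ftC _ _)]
  exact ⟨_, (lipschitzWith_smul (β := ℂ) _).comp hL⟩

/-- Properties of the deconvolution kernel `k`: it is a symmetric probability density with
finite `p`-th moment, its Fourier transform `k*` is supported in `[-1,1]`, bounded by `1`,
and `⌈p⌉` times differentiable with a Lipschitz `⌈p⌉`-th derivative. -/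
theorem ker_properties (p : ℝ) (hp : 1 ≤ p) :
    (∀ x : ℝ, ker p (-x) = ker p x) ∧
    (∀ x : ℝ, 0 ≤ ker p x) ∧
    Integrable (ker p) (volume : Measure ℝ) ∧
    (∫ x : ℝ, ker p x) = 1 ∧
    Integrable (fun u : ℝ => |u| ^ p * ker p u) (volume : Measure ℝ) ∧
    (∀ u : ℝ, 1 < |u| → ftC (ker p) u = 0) ∧
    (∀ u : ℝ, ‖ftC (ker p) u‖ ≤ 1) ∧
    ContDiff ℝ (⌈p⌉₊ : ℕ) (ftC (ker p)) ∧
    ∃ L : NNReal, LipschitzWith L (iteratedDeriv ⌈p⌉₊ (ftC (ker p))) := by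
  have hq := ceil_le_two_mul_ceil_half p
  refine ⟨fun x => by rw [_root_.ker, _root_.ker, ker0_neg], ker_nonneg p, integrable_ker p, integral_ker p,
    integrable_abs_rpow_mul_ker (by linarith), fun u => ftC_ker_eq_zero p, fun u => ?_,
    contDiff_ftC fun k hk => integrable_pow_mul_ker p (hk.trans hq),
    lipschitzWith_iteratedDeriv_ftC_ker p hq⟩
  refine (norm_ftC_le _ _).trans_eq ?_
  simp_rw [abs_of_nonneg (ker_nonneg p _)]
  exact integral_ker p

end
end

section
/- Let k be a probability density on ℝ whose Fourier transform k* is supported in [−1,1] and bounded by 1, let μ_{ε,j} be a probability measure on ℝ whose Fourier transform μ_{ε,j}* never vanishes, and set r_j = 1/μ_{ε,j}*. For h > 0, define k̃_{j,h}(x) = (1/2π) ∫ e^{iux} k*(u)/μ_{ε,j}*(u/h) du. Then ∫_ℝ (1/h) (k̃_{j,h}(u))^2 du ≤ (1/2π) ∫_{−1/h}^{1/h} |r_j(u)|^2 du. -/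
open MeasureTheory Filter

noncomputable section

/-- Fourier transform (characteristic function) of a measure on `ℝ`. -/
def ftMeas (ν : Measure ℝ) (w : ℝ) : ℂ :=
  ∫ t : ℝ, Complex.exp (Complex.I * (w : ℂ) * (t : ℂ)) ∂ν

/-- The deconvolved kernel `k̃_{j,h}(x) = (1/2π) ∫ e^{iux} k*(u)/μ_{ε,j}*(u/h) du`. -/
def ktildeG (k : ℝ → ℝ) (ν : Measure ℝ) (h : ℝ) (x : ℝ) : ℝ :=
  (1 / (2 * Real.pi)) *
    (∫ u : ℝ, Complex.exp (Complex.I * (u : ℂ) * (x : ℂ)) * ftC k u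
      / ftMeas ν (u / h)).re

open scoped FourierTransform SchwartzMap ContDiff in
/-- The `L²` Fourier transform of an integrable function is its Fourier integral. -/
theorem fourier_toLp_ae_eq {f : ℝ → ℂ} (hf : Integrable f) (hf2 : MemLp f 2) :
    (𝓕 (hf2.toLp f) : Lp (α := ℝ) ℂ 2 volume) =ᵐ[volume] 𝓕 f := by
  have hcont : Continuous (𝓕 f) := VectorFourier.fourierIntegral_continuous
    Real.continuous_fourierChar continuous_inner hf
  refine ae_eq_of_integral_contDiff_smul_eq ((Lp.memLp _).locallyIntegrable one_le_two)
    hcont.locallyIntegrable fun g hg hg_supp ↦ ?_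
  have hg₁ : HasCompactSupport (Complex.ofRealCLM ∘ g) := hg_supp.comp_left rfl
  have hg₂ : ContDiff ℝ ∞ (Complex.ofRealCLM ∘ g) := by fun_prop
  set φ : 𝓢(ℝ, ℂ) := hg₁.toSchwartzMap hg₂ with hφ
  have hdist := DFunLike.congr_fun (Lp.fourier_toTemperedDistribution_eq (hf2.toLp f)) φ
  simp only [TemperedDistribution.fourier_apply, Lp.toTemperedDistribution_apply] at hdist
  have hself : ∫ ξ, 𝓕 φ ξ • f ξ = ∫ x, φ x • 𝓕 f x := by
    simpa using! VectorFourier.integral_bilin_fourierIntegral_eq_flip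
      (ContinuousLinearMap.lsmul ℂ ℂ) (L := innerₗ ℝ)
      Real.continuous_fourierChar continuous_inner φ.integrable hf
  have hcongr : ∫ ξ, 𝓕 φ ξ • hf2.toLp f ξ = ∫ ξ, 𝓕 φ ξ • f ξ := by
    refine integral_congr_ae ?_
    filter_upwards [hf2.coeFn_toLp] with x hx
    rw [hx]
  calc ∫ x, g x • (𝓕 (hf2.toLp f) : Lp (α := ℝ) ℂ 2 volume) x
      = ∫ x, φ x • (𝓕 (hf2.toLp f) : Lp (α := ℝ) ℂ 2 volume) x := by simp [hφ]
    _ = ∫ x, φ x • 𝓕 f x := by rw [← hdist, hcongr, hself]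
    _ = ∫ x, g x • 𝓕 f x := by simp [hφ]

open scoped FourierTransform in
/-- Plancherel's theorem for functions in `L¹ ∩ L²`. -/
theorem integrable_and_integral_norm_sq_fourier {f : ℝ → ℂ} (hf : Integrable f)
    (hf2 : MemLp f 2) :
    Integrable (fun x ↦ ‖𝓕 f x‖ ^ 2) ∧ ∫ x, ‖𝓕 f x‖ ^ 2 = ∫ x, ‖f x‖ ^ 2 := by
  have hae := fourier_toLp_ae_eq hf hf2
  have hmem : MemLp (𝓕 f) 2 := (Lp.memLp _).ae_eq hae
  refine ⟨hmem.integrable_norm_pow two_ne_zero, ?_⟩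
  have hinner := Lp.inner_fourier_eq (hf2.toLp f) (hf2.toLp f)
  rw [L2.inner_def, L2.inner_def] at hinner
  have hl : ∫ x, inner ℂ ((𝓕 (hf2.toLp f) : Lp (α := ℝ) ℂ 2 volume) x)
      ((𝓕 (hf2.toLp f) : Lp (α := ℝ) ℂ 2 volume) x) = ((∫ x, ‖𝓕 f x‖ ^ 2 : ℝ) : ℂ) := by
    rw [← integral_complex_ofReal]
    refine integral_congr_ae ?_
    filter_upwards [hae] with x hx
    rw [hx, inner_self_eq_norm_sq_to_K]
    simp
  have hr : ∫ x, inner ℂ (hf2.toLp f x) (hf2.toLp f x) = ((∫ x, ‖f x‖ ^ 2 : ℝ) : ℂ) := by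
    rw [← integral_complex_ofReal]
    refine integral_congr_ae ?_
    filter_upwards [hf2.coeFn_toLp] with x hx
    rw [hx, inner_self_eq_norm_sq_to_K]
    simp
  rw [hl, hr] at hinner
  exact_mod_cast hinner

theorem norm_exp_I_mul_ofReal_mul_ofReal (u x : ℝ) :
    ‖Complex.exp (Complex.I * (u : ℂ) * (x : ℂ))‖ = 1 := by
  rw [mul_assoc, ← Complex.ofReal_mul, Complex.norm_exp_I_mul_ofReal]

theorem continuous_ftC {g : ℝ → ℝ} (hg : Integrable g) : Continuous (ftC g) := by
  refine continuous_of_dominated (bound := fun t ↦ ‖g t‖) (fun w ↦ ?_) (fun w ↦ ?_) hg.norm ?_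
  · exact (Continuous.aestronglyMeasurable (by fun_prop)).mul hg.ofReal.aestronglyMeasurable
  · exact .of_forall fun t ↦ by
      rw [norm_mul, norm_exp_I_mul_ofReal_mul_ofReal, one_mul, Complex.norm_real]
  · exact .of_forall fun t ↦ by fun_prop

theorem continuous_ftMeas (ν : Measure ℝ) [IsFiniteMeasure ν] : Continuous (ftMeas ν) := by
  refine continuous_of_dominated (bound := fun _ ↦ 1) (fun w ↦ ?_) (fun w ↦ ?_)
    (integrable_const 1) ?_
  · exact Continuous.aestronglyMeasurable (by fun_prop)
  · exact .of_forall fun t ↦ (norm_exp_I_mul_ofReal_mul_ofReal w t).le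
  · exact .of_forall fun t ↦ by fun_prop

open scoped FourierTransform in
theorem ktildeG_eq_re_fourier (k : ℝ → ℝ) (ν : Measure ℝ) (h x : ℝ) :
    ktildeG k ν h x = (1 / (2 * Real.pi)) *
      (𝓕 (fun u : ℝ ↦ ftC k u / ftMeas ν (u / h)) (-(1 / (2 * Real.pi)) * x)).re := by
  rw [ktildeG, Real.fourier_real_eq_integral_exp_smul]
  congr 3 with u
  rw [smul_eq_mul, mul_div_assoc]
  congr 2
  have : (Real.pi : ℂ) ≠ 0 := by exact_mod_cast Real.pi_ne_zero
  push_cast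
  field_simp

open scoped FourierTransform in
/-- Plancherel bound: `∫ (1/h) k̃_{j,h}(u)² du ≤ (1/2π) ∫_{-1/h}^{1/h} |r_j(u)|² du`
where `r_j = 1/μ_{ε,j}*`. -/
theorem ktilde_L2_bound
    (k : ℝ → ℝ) (hk0 : ∀ x, 0 ≤ k x) (hkint : Integrable k (volume : Measure ℝ))
    (hk1 : (∫ x : ℝ, k x) = 1)
    (hsupp : ∀ u : ℝ, 1 < |u| → ftC k u = 0)
    (hbd : ∀ u : ℝ, ‖ftC k u‖ ≤ 1)
    (ν : Measure ℝ) [IsProbabilityMeasure ν]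
    (hnz : ∀ w : ℝ, ftMeas ν w ≠ 0)
    (h : ℝ) (hh : 0 < h) :
    (∫ u : ℝ, (1 / h) * (ktildeG k ν h u) ^ 2)
      ≤ (1 / (2 * Real.pi)) *
        ∫ u in Set.Icc (-(1 / h)) (1 / h), ‖(ftMeas ν u)⁻¹‖ ^ 2 := by
  have hcont : Continuous fun u : ℝ ↦ ftC k u / ftMeas ν (u / h) :=
    (continuous_ftC hkint).div ((continuous_ftMeas ν).comp (by fun_prop)) fun u ↦ hnz _
  have hcs : HasCompactSupport fun u : ℝ ↦ ftC k u / ftMeas ν (u / h) := by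
    refine HasCompactSupport.intro (isCompact_Icc (a := -1) (b := 1)) fun u hu ↦ ?_
    rw [hsupp u (not_le.1 fun hle ↦ hu (abs_le.1 hle)), zero_div]
  have hplancherel := integrable_and_integral_norm_sq_fourier
    (hcont.integrable_of_hasCompactSupport hcs) (hcont.memLp_of_hasCompactSupport hcs)
  simp_rw [ktildeG_eq_re_fourier]
  set G : ℝ → ℂ := fun u ↦ ftC k u / ftMeas ν (u / h) with hG
  have hpi := Real.pi_pos
  set c : ℝ := 1 / (2 * Real.pi) with hc
  have hc0 : 0 < c := by positivity
  have hscale : ∫ v, ‖G (h * v)‖ ^ 2 = (1 / h) * ∫ u, ‖G u‖ ^ 2 := by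
    rw [Measure.integral_comp_mul_left (fun u ↦ ‖G u‖ ^ 2) h, abs_of_pos (inv_pos.2 hh),
      smul_eq_mul, one_div]
  calc ∫ u, (1 / h) * (c * (𝓕 G (-c * u)).re) ^ 2
      ≤ ∫ u, (1 / h) * c ^ 2 * ‖𝓕 G (-c * u)‖ ^ 2 := by
        refine integral_mono_of_nonneg (.of_forall fun u ↦ by positivity)
          ((hplancherel.1.comp_mul_left' (neg_ne_zero.2 hc0.ne')).const_mul _)
          (.of_forall fun u ↦ ?_)
        simp only [mul_pow, ← mul_assoc]
        exact mul_le_mul_of_nonneg_left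
          (sq_le_sq.2 ((Complex.abs_re_le_norm _).trans (le_abs_self _))) (by positivity)
    _ = c * ((1 / h) * ∫ u, ‖G u‖ ^ 2) := by
        rw [integral_const_mul, Measure.integral_comp_mul_left (fun u ↦ ‖𝓕 G u‖ ^ 2) (-c),
          hplancherel.2, abs_inv, abs_neg, abs_of_pos hc0, smul_eq_mul]
        field_simp
        rfl
    _ = c * ∫ v, ‖G (h * v)‖ ^ 2 := by rw [hscale]
    _ ≤ c * ∫ u in Set.Icc (-(1 / h)) (1 / h), ‖(ftMeas ν u)⁻¹‖ ^ 2 := by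
        gcongr
        rw [← integral_indicator measurableSet_Icc]
        have hint : IntegrableOn (fun u ↦ ‖(ftMeas ν u)⁻¹‖ ^ 2)
            (Set.Icc (-(1 / h)) (1 / h)) :=
          (((continuous_ftMeas ν).inv₀ hnz).norm.pow 2).integrableOn_Icc
        refine integral_mono_of_nonneg (.of_forall fun u ↦ by positivity)
          (hint.integrable_indicator measurableSet_Icc) (.of_forall fun v ↦ ?_)
        simp only [hG, mul_div_cancel_left₀ v hh.ne']
        by_cases hv : v ∈ Set.Icc (-(1 / h)) (1 / h)
        · rw [Set.indicator_of_mem hv, div_eq_mul_inv, norm_mul]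
          gcongr
          exact mul_le_of_le_one_left (norm_nonneg _) (hbd _)
        · rw [Set.indicator_of_notMem hv, hsupp, zero_div, norm_zero, zero_pow two_ne_zero]
          rw [abs_mul, abs_of_pos hh]
          refine not_le.1 fun hle ↦ hv (abs_le.1 ?_)
          rwa [le_div_iff₀ hh, mul_comm]

end
end
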